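/- arXiv:1212.3898 — 2 statements merged into one kernel-verified Lean document; each statement's English description precedes it below -/
import Mathlib

section
/- If m is an even integer and G is a connected finite simple graph with maximum degree Δ(G) ≥ 3, and n is an integer with 1 < m < n, then χ(G^{m/n}) = ω(G^{m/n}). -/
open SimpleGraph

/-- Representations of vertices of the `n`-subdivision of `G`: `(u, u, 0)` represents the
branch vertex `u`, and for an adjacent pair `(u, v)`, the triple `(u, v, i)` with `i ≤ n`
represents the point at distance `i` from `u` on the path of length `n` replacing the
edge `uv`. -/
def SubdivPre {V : Type*} (G : SimpleGraph V) (n : ℕ) : Type _ :=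
  {p : V × V × ℕ // (p.1 = p.2.1 ∧ p.2.2 = 0) ∨ (G.Adj p.1 p.2.1 ∧ p.2.2 ≤ n)}

/-- The identifications between representations: `(u, v, i)` and `(v, u, n - i)` represent
the same point, and `(u, v, 0)` represents the branch vertex `u`, i.e. `(u, u, 0)`. -/
inductive SubdivRel {V : Type*} (G : SimpleGraph V) (n : ℕ) :
    SubdivPre G n → SubdivPre G n → Prop
  | flip (u v : V) (i : ℕ) (h : G.Adj u v) (hi : i ≤ n) :
      SubdivRel G n ⟨(u, v, i), Or.inr ⟨h, hi⟩⟩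
        ⟨(v, u, n - i), Or.inr ⟨h.symm, Nat.sub_le n i⟩⟩
  | collapse (u v : V) (h : G.Adj u v) :
      SubdivRel G n ⟨(u, v, 0), Or.inr ⟨h, Nat.zero_le n⟩⟩ ⟨(u, u, 0), Or.inl ⟨rfl, rfl⟩⟩

/-- The vertex set of the `n`-subdivision of `G`. -/
def SubdivVert {V : Type*} (G : SimpleGraph V) (n : ℕ) : Type _ := Quot (SubdivRel G n)

/-- The branch vertex of the subdivision corresponding to a vertex `u` of `G`. -/
def branchVertex {V : Type*} (G : SimpleGraph V) (n : ℕ) (u : V) : SubdivVert G n :=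
  Quot.mk _ ⟨(u, u, 0), Or.inl ⟨rfl, rfl⟩⟩

/-- The vertex `(uv)_i` of the subdivision: the point at distance `i` from `u` on the
path of length `n` replacing the edge `uv`. -/
def mkVert {V : Type*} (G : SimpleGraph V) (n : ℕ) {u v : V} (h : G.Adj u v)
    (i : ℕ) (hi : i ≤ n) : SubdivVert G n :=
  Quot.mk _ ⟨(u, v, i), Or.inr ⟨h, hi⟩⟩

/-- The `n`-subdivision `G^{1/n}` of `G`: each edge of `G` is replaced by a path of
length `n`; consecutive points on such a path are adjacent. -/
def subdivision {V : Type*} (G : SimpleGraph V) (n : ℕ) : SimpleGraph (SubdivVert G n) :=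
  SimpleGraph.fromRel (fun x y => ∃ (u v : V) (h : G.Adj u v) (i : ℕ) (hi : i < n),
    x = mkVert G n h i (le_of_lt hi) ∧ y = mkVert G n h (i + 1) hi)

/-- The `m`-power of a graph: two distinct vertices are adjacent iff their distance is
at most `m`, i.e. iff there is a walk of length at most `m` between them. -/
def powerGraph {W : Type*} (H : SimpleGraph W) (m : ℕ) : SimpleGraph W :=
  SimpleGraph.fromRel (fun x y => ∃ w : H.Walk x y, w.length ≤ m)

/-- The fractional power `G^{m/n}`, the `m`-power of the `n`-subdivision of `G`. -/
def fracPower {V : Type*} (G : SimpleGraph V) (m n : ℕ) : SimpleGraph (SubdivVert G n) :=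
  powerGraph (subdivision G n) m


namespace FracPow

/-! ### Geometry of the subdivision -/

section Geometry

variable {V : Type*} {G : SimpleGraph V} {n : ℕ}

open Classical in
/-- A normal form separating the points of the subdivision. -/
noncomputable def nfPre (G : SimpleGraph V) (n : ℕ) (p : SubdivPre G n) : V ⊕ Set (V × V × ℕ) :=
  if p.1.2.2 = 0 then Sum.inl p.1.1
  else if p.1.2.2 = n then Sum.inl p.1.2.1
  else Sum.inr {(p.1.1, p.1.2.1, p.1.2.2), (p.1.2.1, p.1.1, n - p.1.2.2)}

theorem nfPre_rel (hn : 0 < n) (a b : SubdivPre G n) (h : SubdivRel G n a b) :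
    nfPre G n a = nfPre G n b := by
  cases h with
  | flip u v i h hi =>
    unfold nfPre
    dsimp only
    by_cases h0 : i = 0
    · subst h0
      simp [hn.ne']
    · by_cases h1 : i = n
      · subst h1
        simp [hn.ne']
      · have h2 : n - i ≠ 0 := by omega
        have h3 : n - i ≠ n := by omega
        have h4 : n - (n - i) = i := by omega
        rw [if_neg h0, if_neg h1, if_neg h2, if_neg h3, h4, Set.pair_comm]
  | collapse u v h => simp [nfPre]

theorem mkVert_eq (hn : 0 < n) {u v a b : V} {h : G.Adj u v} {h' : G.Adj a b} {i s : ℕ}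
    {hi : i ≤ n} {hs : s ≤ n} (heq : mkVert G n h i hi = mkVert G n h' s hs) :
    (u = a ∧ v = b ∧ i = s) ∨ (u = b ∧ v = a ∧ i + s = n) ∨ (i = 0 ∧ s = 0 ∧ u = a) ∨
    (i = 0 ∧ s = n ∧ u = b) ∨ (i = n ∧ s = 0 ∧ v = a) ∨ (i = n ∧ s = n ∧ v = b) := by
  have := congrArg (Quot.lift (nfPre G n) (nfPre_rel hn)) heq
  have h2 : nfPre G n ⟨(u, v, i), Or.inr ⟨h, hi⟩⟩ = nfPre G n ⟨(a, b, s), Or.inr ⟨h', hs⟩⟩ := this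
  unfold nfPre at h2
  dsimp only at h2
  split_ifs at h2 with h3 h4 h5 h6 h7 h8 h9
  · simp only [Sum.inl.injEq] at h2; simp_all
  · simp only [Sum.inl.injEq] at h2; simp_all
  · simp only [Sum.inl.injEq] at h2; simp_all
  · simp only [Sum.inl.injEq] at h2; simp_all
  · simp only [Sum.inr.injEq] at h2
    have h9 : (u, v, i) ∈ ({(a, b, s), (b, a, n - s)} : Set (V × V × ℕ)) := by
      rw [← h2]; simp
    simp only [Set.mem_insert_iff, Set.mem_singleton_iff, Prod.mk.injEq] at h9
    rcases h9 with ⟨rfl, rfl, rfl⟩ | ⟨rfl, rfl, rfl⟩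
    · exact Or.inl ⟨rfl, rfl, rfl⟩
    · exact Or.inr (Or.inl ⟨rfl, rfl, by omega⟩)

theorem mkVert_flip {u v : V} (h : G.Adj u v) (i j : ℕ) (hi : i ≤ n) (hj : j ≤ n)
    (hij : i + j = n) : mkVert G n h i hi = mkVert G n h.symm j hj := by
  obtain rfl : j = n - i := by omega
  exact Quot.sound (SubdivRel.flip u v i h hi)

theorem mkVert_zero {u v : V} (h : G.Adj u v) :
    mkVert G n h 0 (Nat.zero_le n) = branchVertex G n u :=
  Quot.sound (SubdivRel.collapse u v h)

theorem mkVert_congr {u v : V} (h : G.Adj u v) {i j : ℕ} (hi : i ≤ n) (hij : i = j) :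
    mkVert G n h i hi = mkVert G n h j (hij ▸ hi) := by
  subst hij; rfl

theorem nbr_aux (hn : 0 < n) {u v a b : V} (h : G.Adj u v) (h' : G.Adj a b) (j s : ℕ) (hj : j ≤ n)
    (hs : s < n) (heq : mkVert G n h j hj = mkVert G n h' s hs.le) :
    (∃ j', ∃ hj' : j' ≤ n, (j' = j + 1 ∨ j = j' + 1) ∧
      mkVert G n h' (s + 1) hs = mkVert G n h j' hj') ∨
    (j = 0 ∧ ∃ w, ∃ hw : G.Adj u w, mkVert G n h' (s + 1) hs = mkVert G n hw 1 hn) ∨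
    (j = n ∧ ∃ w, ∃ hw : G.Adj v w, mkVert G n h' (s + 1) hs = mkVert G n hw 1 hn) := by
  rcases mkVert_eq hn heq with ⟨rfl, rfl, rfl⟩ | ⟨rfl, rfl, h1⟩ | ⟨rfl, rfl, rfl⟩ | ⟨_, h1, _⟩ |
    ⟨rfl, rfl, rfl⟩ | ⟨_, h1, _⟩
  · exact Or.inl ⟨j + 1, hs, Or.inl rfl, rfl⟩
  · exact Or.inl ⟨j - 1, by omega, Or.inr (by omega), mkVert_flip _ _ _ _ _ (by omega)⟩
  · exact Or.inr (Or.inl ⟨rfl, b, h', rfl⟩)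
  · omega
  · exact Or.inr (Or.inr ⟨rfl, b, h', rfl⟩)
  · omega

theorem nbr (hn : 0 < n) {u v : V} (h : G.Adj u v) (j : ℕ) (hj : j ≤ n) (z : SubdivVert G n)
    (hz : (subdivision G n).Adj (mkVert G n h j hj) z) :
    (∃ j', ∃ hj' : j' ≤ n, (j' = j + 1 ∨ j = j' + 1) ∧ z = mkVert G n h j' hj') ∨
    (j = 0 ∧ ∃ w, ∃ hw : G.Adj u w, z = mkVert G n hw 1 hn) ∨
    (j = n ∧ ∃ w, ∃ hw : G.Adj v w, z = mkVert G n hw 1 hn) := by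
  rw [subdivision, SimpleGraph.fromRel_adj] at hz
  obtain ⟨_, ⟨a, b, h', s, hs, hx, rfl⟩ | ⟨a, b, h', s, hs, rfl, hx⟩⟩ := hz
  · exact nbr_aux hn h h' j s hj hs hx
  · rw [mkVert_flip h' (s + 1) (n - s - 1) _ (by omega) (by omega)] at hx
    have := nbr_aux hn h h'.symm j (n - s - 1) hj (by omega) hx
    rwa [← mkVert_flip h' s (n - s - 1 + 1) hs.le (by omega) (by omega)] at this

/-- Points reachable in at most `L` steps from `(u v)_i`. -/
def Reach (G : SimpleGraph V) (n : ℕ) {u v : V} (h : G.Adj u v) (i L : ℕ)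
    (y : SubdivVert G n) : Prop :=
  (∃ j, ∃ hj : j ≤ n, y = mkVert G n h j hj ∧ j ≤ i + L ∧ i ≤ j + L) ∨
  (∃ w, ∃ hw : G.Adj u w, ∃ j, ∃ hj : j ≤ n, y = mkVert G n hw j hj ∧ i + j ≤ L) ∨
  (∃ w, ∃ hw : G.Adj v w, ∃ j, ∃ hj : j ≤ n, y = mkVert G n hw j hj ∧ n - i + j ≤ L)

theorem Reach.step (hn : 0 < n) {u v : V} {h : G.Adj u v} {i L : ℕ}
    {y z : SubdivVert G n} (hL : L < n) (hi : i ≤ n)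
    (hy : Reach G n h i L y) (hz : (subdivision G n).Adj y z) : Reach G n h i (L + 1) z := by
  rcases hy with ⟨j, hj, rfl, h1, h2⟩ | ⟨w, hw, j, hj, rfl, h1⟩ | ⟨w, hw, j, hj, rfl, h1⟩
  · rcases nbr hn h j hj z hz with ⟨j', hj', h3, rfl⟩ | ⟨rfl, w, hw, rfl⟩ | ⟨rfl, w, hw, rfl⟩
    · exact Or.inl ⟨j', hj', rfl, by omega, by omega⟩
    · exact Or.inr (Or.inl ⟨w, hw, 1, hn, rfl, by omega⟩)
    · exact Or.inr (Or.inr ⟨w, hw, 1, hn, rfl, by omega⟩)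
  · rcases nbr hn hw j hj z hz with ⟨j', hj', h3, rfl⟩ | ⟨rfl, w, hw, rfl⟩ | ⟨rfl, w, hw, rfl⟩
    · exact Or.inr (Or.inl ⟨w, hw, j', hj', rfl, by omega⟩)
    · exact Or.inr (Or.inl ⟨w, hw, 1, hn, rfl, by omega⟩)
    · omega
  · rcases nbr hn hw j hj z hz with ⟨j', hj', h3, rfl⟩ | ⟨rfl, w, hw, rfl⟩ | ⟨rfl, w, hw, rfl⟩
    · exact Or.inr (Or.inr ⟨w, hw, j', hj', rfl, by omega⟩)
    · exact Or.inr (Or.inr ⟨w, hw, 1, hn, rfl, by omega⟩)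
    · omega

theorem reach_of_walk (hn : 0 < n) {u v : V} (h : G.Adj u v) (i : ℕ) (hi : i ≤ n)
    {y x : SubdivVert G n} (w : (subdivision G n).Walk y x) (hx : x = mkVert G n h i hi)
    (hw : w.length ≤ n) : Reach G n h i w.length y := by
  induction w with
  | nil => exact Or.inl ⟨i, hi, hx, by simp, by simp⟩
  | cons hadj w' ih =>
    rw [SimpleGraph.Walk.length_cons] at hw ⊢
    exact Reach.step hn (by omega) hi (ih hx (by omega)) hadj.symm

/-- Conditions under which a labelling of the points of the subdivision is a proper colouring
of the `m`-power. -/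
structure ArmOK {α : Type*} (G : SimpleGraph V) (m n : ℕ) (Valid : α → Prop)
    (arm : V → V → ℕ → α) : Prop where
  val : ∀ u v, G.Adj u v → ∀ i, i ≤ n → Valid (arm u v i)
  sym : ∀ u v, G.Adj u v → ∀ i, i ≤ n → arm u v i = arm v u (n - i)
  zero : ∀ u v w, G.Adj u v → G.Adj u w → arm u v 0 = arm u w 0
  win : ∀ u v, G.Adj u v → ∀ i j, i < j → j ≤ n → j ≤ i + m → arm u v i ≠ arm u v j
  star : ∀ u v w, G.Adj u v → G.Adj u w → v ≠ w → ∀ i j, 1 ≤ i → 1 ≤ j → i + j ≤ m →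
    arm u v i ≠ arm u w j

theorem ArmOK.win' {α : Type*} {m : ℕ} {Valid : α → Prop} {arm : V → V → ℕ → α}
    (H : ArmOK G m n Valid arm) {u v : V} (h : G.Adj u v) {i j : ℕ} (hij : i ≠ j)
    (hi : i ≤ n) (hj : j ≤ n) (h1 : j ≤ i + m) (h2 : i ≤ j + m) : arm u v i ≠ arm u v j := by
  rcases lt_or_gt_of_ne hij with h3 | h3
  · exact H.win u v h i j h3 hj h1
  · exact (H.win u v h j i h3 hi h2).symm

theorem ArmOK.star' {α : Type*} {m : ℕ} {Valid : α → Prop} {arm : V → V → ℕ → α}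
    (H : ArmOK G m n Valid arm) {u v w : V} (h : G.Adj u v) (hw : G.Adj u w)
    {i j : ℕ} (hi : i ≤ n) (hj : j ≤ n) (h1 : i + j ≤ m)
    (hne : mkVert G n h i hi ≠ mkVert G n hw j hj) : arm u v i ≠ arm u w j := by
  by_cases hvw : v = w
  · subst hvw
    refine H.win' h ?_ hi hj (by omega) (by omega)
    rintro rfl
    exact hne rfl
  · by_cases h0 : i = 0
    · subst h0
      rw [H.zero u v w h hw]
      refine H.win' hw ?_ hi hj (by omega) (by omega)
      rintro rfl
      exact hne (by rw [mkVert_zero, mkVert_zero])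
    · by_cases h0' : j = 0
      · subst h0'
        rw [H.zero u w v hw h]
        exact H.win' h h0 hi (Nat.zero_le _) (by omega) (by omega)
      · exact H.star u v w h hw hvw i j (by omega) (by omega) h1

open Classical in
theorem exists_coloring {α : Type*} {m : ℕ} {Valid : α → Prop} {arm : V → V → ℕ → α}
    (H : ArmOK G m n Valid arm) (hmn : m < n) (hnb : ∀ u, ∃ v, G.Adj u v) :
    Nonempty ((fracPower G m n).Coloring {x : α // Valid x}) := by
  choose nb hnb using hnb
  let f : SubdivPre G n → α := fun p =>
    if p.1.1 = p.1.2.1 then arm p.1.1 (nb p.1.1) 0 else arm p.1.1 p.1.2.1 p.1.2.2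
  have hf : ∀ a b, SubdivRel G n a b → f a = f b := by
    intro a b hab
    cases hab with
    | flip u v i h hi =>
      simp only [f, if_neg h.ne, if_neg h.ne.symm]
      exact H.sym u v h i hi
    | collapse u v h =>
      simp only [f, if_neg h.ne, if_true]
      exact H.zero u v (nb u) h (hnb u)
  let F : SubdivVert G n → α := Quot.lift f hf
  have hF : ∀ {u v : V} (h : G.Adj u v) (i : ℕ) (hi : i ≤ n),
      F (mkVert G n h i hi) = arm u v i := by
    intro u v h i hi
    change f _ = _
    simp only [f, if_neg h.ne]
  have hrep : ∀ x : SubdivVert G n, ∃ u v, ∃ h : G.Adj u v, ∃ i, ∃ hi : i ≤ n,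
      x = mkVert G n h i hi := by
    intro x
    induction x using Quot.ind with
    | mk p =>
      obtain ⟨⟨u, v, i⟩, hp⟩ := p
      rcases hp with ⟨h1, h2⟩ | ⟨h1, h2⟩
      · dsimp only at h1 h2
        subst h1 h2
        exact ⟨u, nb u, hnb u, 0, Nat.zero_le _, (mkVert_zero (hnb u)).symm⟩
      · exact ⟨u, v, h1, i, h2, rfl⟩
  have key : ∀ x y : SubdivVert G n, x ≠ y → (∃ w : (subdivision G n).Walk y x, w.length ≤ m) →
      F x ≠ F y := by
    intro x y hxy ⟨w, hw⟩
    obtain ⟨u, v, h, i, hi, rfl⟩ := hrep x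
    rcases reach_of_walk (by omega) h i hi w rfl (by omega) with
      ⟨j, hj, rfl, h1, h2⟩ | ⟨w', hw', j, hj, rfl, h1⟩ | ⟨w', hw', j, hj, rfl, h1⟩
    · rw [hF, hF]
      refine H.win' h ?_ hi hj (by omega) (by omega)
      rintro rfl
      exact hxy rfl
    · rw [hF, hF]
      exact H.star' h hw' hi hj (by omega) hxy
    · rw [mkVert_flip h i (n - i) hi (by omega) (by omega)] at hxy ⊢
      rw [hF, hF]
      exact H.star' h.symm hw' _ hj (by omega) hxy
  have hval : ∀ x, Valid (F x) := by
    intro x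
    obtain ⟨u, v, h, i, hi, rfl⟩ := hrep x
    rw [hF]
    exact H.val u v h i hi
  refine ⟨SimpleGraph.Coloring.mk (fun x => ⟨F x, hval x⟩) ?_⟩
  intro x y hxy
  rw [fracPower, powerGraph, SimpleGraph.fromRel_adj] at hxy
  obtain ⟨hne, ⟨w, hw⟩ | ⟨w, hw⟩⟩ := hxy
  · intro h
    exact key x y hne ⟨w.reverse, by simpa using hw⟩ (congrArg Subtype.val h)
  · intro h
    exact key x y hne ⟨w, hw⟩ (congrArg Subtype.val h)

/-- Lengthening the subdivision by `m + 1`. -/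
theorem ArmOK.extend {α : Type*} {m : ℕ} {Valid : α → Prop} {arm : V → V → ℕ → α}
    (H : ArmOK G m n Valid arm) (hmn : m < n) (idx : V → ℕ) (hidx : Function.Injective idx) :
    ∃ arm', ArmOK G m (n + (m + 1)) Valid arm' := by
  let cut : V → V → ℕ := fun u v => if idx u < idx v then m else n
  have hc1 : ∀ u v, m ≤ cut u v ∧ cut u v ≤ n := by
    intro u v
    simp only [cut]
    split_ifs <;> omega
  have hc2 : ∀ u v, G.Adj u v → cut u v + cut v u = m + n := by
    intro u v h
    have : idx u ≠ idx v := fun h' => h.ne (hidx h')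
    simp only [cut]
    split_ifs <;> omega
  refine ⟨fun u v i => if i ≤ cut u v then arm u v i else arm u v (i - (m + 1)), ?_, ?_, ?_, ?_, ?_⟩
  · intro u v h i hi
    have := hc1 u v
    split_ifs
    · exact H.val u v h _ (by omega)
    · exact H.val u v h _ (by omega)
  · intro u v h i hi
    have := hc1 u v
    have := hc2 u v h
    split_ifs
    · omega
    · rw [H.sym u v h i (by omega)]
      congr 1
      omega
    · rw [H.sym u v h _ (by omega)]
      congr 1
      omega
    · omega
  · intro u v w h h'
    rw [if_pos (Nat.zero_le _), if_pos (Nat.zero_le _)]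
    exact H.zero u v w h h'
  · intro u v h i j hij hj hjm
    have := hc1 u v
    split_ifs
    · exact H.win' h (by omega) (by omega) (by omega) (by omega) (by omega)
    · exact H.win' h (by omega) (by omega) (by omega) (by omega) (by omega)
    · omega
    · exact H.win' h (by omega) (by omega) (by omega) (by omega) (by omega)
  · intro u v w h h' hvw i j hi hj hij
    have := hc1 u v
    have := hc1 u w
    rw [if_pos (by omega), if_pos (by omega)]
    exact H.star u v w h h' hvw i j hi hj hij

theorem ArmOK.extend_many {α : Type*} {m : ℕ} {Valid : α → Prop} 
    (hmn : m < n) (idx : V → ℕ) (hidx : Function.Injective idx)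
    (H : ∃ arm : V → V → ℕ → α, ArmOK G m n Valid arm) (t : ℕ) :
    ∃ arm' : V → V → ℕ → α, ArmOK G m (n + (m + 1) * t) Valid arm' := by
  induction t with
  | zero => simpa using H
  | succ t ih =>
    obtain ⟨arm, h⟩ := ih
    have := h.extend (by nlinarith) idx hidx
    rwa [add_assoc, ← Nat.mul_succ] at this

end Geometry

end FracPow

namespace FracPow

section LowerBound

variable {V : Type*} {G : SimpleGraph V} {n : ℕ}

theorem exists_walk_branch (hn : 1 < n) {u v : V} (h : G.Adj u v) (i : ℕ) (hi : i ≤ n) :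
    ∃ w : (subdivision G n).Walk (branchVertex G n u) (mkVert G n h i hi), w.length = i := by
  induction i with
  | zero =>
    rw [mkVert_zero]
    exact ⟨SimpleGraph.Walk.nil, rfl⟩
  | succ i ih =>
    obtain ⟨w, hw⟩ := ih (by omega)
    have hadj : (subdivision G n).Adj (mkVert G n h i (by omega)) (mkVert G n h (i + 1) hi) := by
      rw [subdivision, SimpleGraph.fromRel_adj]
      refine ⟨?_, Or.inl ⟨u, v, h, i, hi, rfl, rfl⟩⟩
      intro heq
      have h3 := h.ne
      rcases mkVert_eq (by omega) heq with h1 | h1 | h1 | h1 | h1 | h1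
      · omega
      · exact h3 h1.1
      all_goals omega
    exact ⟨w.concat hadj, by simp [hw]⟩

theorem finite_subdivVert [Finite V] (G : SimpleGraph V) (n : ℕ) : Finite (SubdivVert G n) := by
  have hb : ∀ p : SubdivPre G n, p.1.2.2 < n + 1 := by
    rintro ⟨p, hp | hp⟩
    · dsimp only
      omega
    · dsimp only
      omega
  have : Finite (SubdivPre G n) := by
    refine Finite.of_injective
      (fun p : SubdivPre G n => ((p.1.1, p.1.2.1, ⟨p.1.2.2, hb p⟩) : V × V × Fin (n + 1))) ?_
    intro p q hpq
    simp only [Prod.mk.injEq, Fin.mk.injEq] at hpq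
    exact Subtype.ext (Prod.ext hpq.1 (Prod.ext hpq.2.1 hpq.2.2))
  exact Finite.of_surjective (Quot.mk (SubdivRel G n)) Quot.mk_surjective

theorem le_cliqueNum [Fintype V] (G : SimpleGraph V) [DecidableRel G.Adj] [Nonempty V]
    (k n : ℕ) (hk : 1 ≤ k) (hkn : 2 * k < n) :
    k * G.maxDegree + 1 ≤ (fracPower G (2 * k) n).cliqueNum := by
  classical
  have := finite_subdivVert G n
  obtain ⟨u, hu⟩ := G.exists_maximal_degree_vertex
  let f : Option (G.neighborSet u × Fin k) → SubdivVert G n := fun o =>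
    o.elim (branchVertex G n u) (fun x => mkVert G n x.1.2 (x.2.1 + 1) (by omega))
  have hlen : ∀ o, ∃ w : (subdivision G n).Walk (branchVertex G n u) (f o), w.length ≤ k := by
    rintro (_ | ⟨v, i⟩)
    · exact ⟨SimpleGraph.Walk.nil, Nat.zero_le _⟩
    · obtain ⟨w, hw⟩ := exists_walk_branch (G := G) (n := n) (by omega) v.2 (i.1 + 1) (by omega)
      exact ⟨w, hw.le.trans i.2⟩
  have hf : Function.Injective f := by
    rintro (_ | ⟨v, i⟩) (_ | ⟨w, j⟩) heq
    · rfl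
    · change branchVertex G n u = mkVert G n w.2 (j.1 + 1) (by omega) at heq
      rw [← mkVert_zero w.2] at heq
      have h3 := w.2.ne
      rcases mkVert_eq (by omega) heq with h1 | h1 | h1 | h1 | h1 | h1
      · omega
      · exact absurd h1.1 h3
      all_goals omega
    · change mkVert G n v.2 (i.1 + 1) (by omega) = branchVertex G n u at heq
      rw [← mkVert_zero v.2] at heq
      have h3 := v.2.ne
      rcases mkVert_eq (by omega) heq with h1 | h1 | h1 | h1 | h1 | h1
      · omega
      · exact absurd h1.1 h3
      all_goals omega
    · change mkVert G n v.2 (i.1 + 1) (by omega) = mkVert G n w.2 (j.1 + 1) (by omega) at heq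
      have h3 := w.2.ne
      rcases mkVert_eq (by omega) heq with h1 | h1 | h1 | h1 | h1 | h1
      · have h4 : v = w := Subtype.ext h1.2.1
        have h5 : i = j := Fin.ext (by omega)
        rw [h4, h5]
      · exact absurd h1.1 h3
      all_goals omega
  have hcl : (fracPower G (2 * k) n).IsClique ((Finset.univ.map ⟨f, hf⟩ : Finset _) : Set _) := by
    intro x hx y hy hxy
    simp only [Finset.coe_map, Function.Embedding.coeFn_mk, Finset.coe_univ, Set.image_univ,
      Set.mem_range] at hx hy
    obtain ⟨a, rfl⟩ := hx
    obtain ⟨b, rfl⟩ := hy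
    obtain ⟨w1, hw1⟩ := hlen a
    obtain ⟨w2, hw2⟩ := hlen b
    rw [fracPower, powerGraph, SimpleGraph.fromRel_adj]
    refine ⟨hxy, Or.inl ⟨w1.reverse.append w2, ?_⟩⟩
    rw [SimpleGraph.Walk.length_append, SimpleGraph.Walk.length_reverse]
    omega
  have hcard := hcl.card_le_cliqueNum
  rw [Finset.card_map, Finset.card_univ, Fintype.card_option, Fintype.card_prod, Fintype.card_fin,
    G.card_neighborSet_eq_degree, ← hu, mul_comm] at hcard
  exact hcard

end LowerBound

/-! ### Bipartite edge colouring -/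

section Konig

variable {E A B : Type*}

/-- The alternating component used in the proof of König's edge colouring theorem. -/
inductive KReach (T : Finset E) (f : E → A) (g : E → B) (c : E → ℕ) (a b : ℕ) (y : B) : E → Prop
  | base (e : E) (he : e ∈ T) (hg : g e = y) (hc : c e = a) : KReach T f g c a b y e
  | stepA (e e' : E) (h : KReach T f g c a b y e) (hc : c e = a) (he : e' ∈ T) (hf : f e' = f e)
      (hc' : c e' = b) : KReach T f g c a b y e'
  | stepB (e e' : E) (h : KReach T f g c a b y e) (hc : c e = b) (he : e' ∈ T) (hg : g e' = g e)
      (hc' : c e' = a) : KReach T f g c a b y e'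

theorem exists_missing [DecidableEq E] {C : Type*} [DecidableEq C] (T : Finset E) (f : E → C)
    (D : ℕ) (c : E → ℕ) (x : C) (e0 : E)
    (he0 : e0 ∉ T) (hx : f e0 = x) (hD : ((insert e0 T).filter (fun e => f e = x)).card ≤ D) :
    ∃ a < D, ∀ e ∈ T, f e = x → c e ≠ a := by
  by_contra hcon
  push Not at hcon
  have h1 : Finset.range D ⊆ (T.filter (fun e => f e = x)).image c := by
    intro a ha
    obtain ⟨e, he, hfe, hce⟩ := hcon a (Finset.mem_range.1 ha)
    exact Finset.mem_image.2 ⟨e, Finset.mem_filter.2 ⟨he, hfe⟩, hce⟩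
  have h2 := (Finset.card_le_card h1).trans Finset.card_image_le
  rw [Finset.card_range] at h2
  rw [Finset.filter_insert, if_pos hx, Finset.card_insert_of_notMem (by simp [he0])] at hD
  omega

theorem konig_finset [DecidableEq E] [DecidableEq A] [DecidableEq B] (T : Finset E)
    (f : E → A) (g : E → B) (D : ℕ)
    (hf : ∀ x, (T.filter (fun e => f e = x)).card ≤ D)
    (hg : ∀ y, (T.filter (fun e => g e = y)).card ≤ D) :
    ∃ c : E → ℕ, (∀ e ∈ T, c e < D) ∧
      (∀ e ∈ T, ∀ e' ∈ T, e ≠ e' → (f e = f e' ∨ g e = g e') → c e ≠ c e') := by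
  classical
  induction T using Finset.induction_on with
  | empty => exact ⟨fun _ => 0, by simp, by simp⟩
  | insert e0 T he0 ih =>
    obtain ⟨c, hc1, hc2⟩ := ih
      (fun x => (Finset.card_le_card (Finset.filter_subset_filter _ (Finset.subset_insert _ _))).trans
        (hf x))
      (fun x => (Finset.card_le_card (Finset.filter_subset_filter _ (Finset.subset_insert _ _))).trans
        (hg x))
    obtain ⟨a, haD, ha⟩ := exists_missing T f D c (f e0) e0 he0 rfl (hf _)
    obtain ⟨b, hbD, hb⟩ := exists_missing T g D c (g e0) e0 he0 rfl (hg _)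
    have hR : ∀ e, KReach T f g c a b (g e0) e → e ∈ T ∧ (c e = a ∨ c e = b) := by
      intro e h
      cases h with
      | base _ h1 h2 h3 => exact ⟨h1, Or.inl h3⟩
      | stepA _ _ h1 h2 h3 h4 h5 => exact ⟨h3, Or.inr h5⟩
      | stepB _ _ h1 h2 h3 h4 h5 => exact ⟨h3, Or.inl h5⟩
    -- elements of the component with colour `b` are not at `f e0`, and closure properties
    have hclA : ∀ e e', KReach T f g c a b (g e0) e → e' ∈ T → (f e = f e' ∨ g e = g e') →
        e ≠ e' → (c e' = a ∨ c e' = b) → KReach T f g c a b (g e0) e' := by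
      intro e e' he he' hfg hne hcc
      obtain ⟨heT, h1⟩ := hR e he
      have hne2 := hc2 e heT e' he' hne hfg
      rcases hfg with hf' | hg'
      · rcases h1 with h1 | h1
        · have h2 : c e' = b := by
            rcases hcc with h | h
            · exact absurd (h1.trans h.symm) hne2
            · exact h
          exact KReach.stepA e e' he h1 he' hf'.symm h2
        · have h2 : c e' = a := by
            rcases hcc with h | h
            · exact h
            · exact absurd (h1.trans h.symm) hne2
          cases he with
          | base _ _ _ h3 => exact absurd (h3.trans h2.symm) hne2
          | stepA e1 _ h3 h4 h5 h6 h7 =>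
            by_cases h8 : e1 = e'
            · exact h8 ▸ h3
            · exact absurd (h4.trans h2.symm) (hc2 e1 (hR e1 h3).1 e' he' h8
                (Or.inl (h6.symm.trans hf')))
          | stepB _ _ h3 h4 h5 h6 h7 => exact absurd (h7.trans h2.symm) hne2
      · rcases h1 with h1 | h1
        · have h2 : c e' = b := by
            rcases hcc with h | h
            · exact absurd (h1.trans h.symm) hne2
            · exact h
          cases he with
          | base _ _ h3 _ => exact absurd h2 (hb e' he' (hg'.symm.trans h3))
          | stepA e1 _ h3 h4 h5 h6 h7 => exact absurd (h7.trans h2.symm) hne2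
          | stepB e1 _ h3 h4 h5 h6 h7 =>
            by_cases h8 : e1 = e'
            · exact h8 ▸ h3
            · exact absurd (h4.trans h2.symm) (hc2 e1 (hR e1 h3).1 e' he' h8
                (Or.inr (h6.symm.trans hg')))
        · have h2 : c e' = a := by
            rcases hcc with h | h
            · exact h
            · exact absurd (h1.trans h.symm) hne2
          exact KReach.stepB e e' he h1 he' hg'.symm h2
    -- no element of the component lies at `f e0`
    have hnx : ∀ e, KReach T f g c a b (g e0) e → f e ≠ f e0 := by
      intro e he
      induction he with
      | base e h1 h2 h3 => exact fun h => ha e h1 h h3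
      | stepA e e' h1 h2 h3 h4 h5 ih => rwa [h4]
      | stepB e e' h1 h2 h3 h4 h5 ih => exact fun h => ha e' h3 h h5
    let sw : ℕ → ℕ := fun x => if x = a then b else if x = b then a else x
    have hswinj : ∀ x y, x ≠ y → sw x ≠ sw y := by
      intro x y hxy
      simp only [sw]
      split_ifs <;> omega
    have hsw : ∀ x, x ≠ a → x ≠ b → sw x = x := by
      intro x h1 h2
      simp [sw, h1, h2]
    have hswab : ∀ x, (x = a ∨ x = b) → (sw x = a ∨ sw x = b) := by
      intro x h
      simp only [sw]
      split_ifs <;> omega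
    let c1 : E → ℕ := fun e => if KReach T f g c a b (g e0) e then sw (c e) else c e
    have hc1T : ∀ e ∈ T, ∀ e' ∈ T, e ≠ e' → (f e = f e' ∨ g e = g e') → c1 e ≠ c1 e' := by
      intro e he e' he' hne hfg
      have h0 := hc2 e he e' he' hne hfg
      simp only [c1]
      split_ifs with h1 h2 h2
      · exact hswinj _ _ h0
      · have h3 : ¬ (c e' = a ∨ c e' = b) := fun h => h2 (hclA e e' h1 he' hfg hne h)
        have h4 := hswab _ (hR e h1).2
        omega
      · have h3 : ¬ (c e = a ∨ c e = b) := fun h => h1 (hclA e' e h2 he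
          (by rcases hfg with h | h; exacts [Or.inl h.symm, Or.inr h.symm]) hne.symm h)
        have h4 := hswab _ (hR e' h2).2
        omega
      · exact h0
    have hc1D : ∀ e ∈ T, c1 e < D := by
      intro e he
      have := hc1 e he
      simp only [c1, sw]
      split_ifs <;> omega
    have hc1a : ∀ e ∈ T, (f e0 = f e ∨ g e0 = g e) → c1 e ≠ a := by
      intro e he hfg
      simp only [c1]
      split_ifs with h1
      · rcases hfg with h | h
        · exact absurd h.symm (hnx e h1)
        · have h2 := hb e he h.symm
          have h3 := (hR e h1).2
          have h4 : c e = a := by tauto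
          simp only [sw, h4, if_true]
          omega
      · rcases hfg with h | h
        · exact ha e he h.symm
        · exact fun h2 => h1 (KReach.base e he h.symm h2)
    refine ⟨fun e => if e = e0 then a else c1 e, ?_, ?_⟩
    · intro e he
      dsimp only
      split_ifs with h
      · exact haD
      · exact hc1D e (Finset.mem_of_mem_insert_of_ne he h)
    · intro e he e' he' hne hfg
      dsimp only
      split_ifs with h h' h'
      · exact absurd (h.trans h'.symm) hne
      · subst h
        exact (hc1a e' (Finset.mem_of_mem_insert_of_ne he' h') hfg).symm
      · subst h'
        exact hc1a e (Finset.mem_of_mem_insert_of_ne he h)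
          (by rcases hfg with h | h; exacts [Or.inl h.symm, Or.inr h.symm])
      · exact hc1T e (Finset.mem_of_mem_insert_of_ne he h) e'
          (Finset.mem_of_mem_insert_of_ne he' h') hne hfg

/-- König's edge colouring theorem, for a bipartite multigraph with edge set `E`. -/
theorem konig [Finite E] (f : E → A) (g : E → B) (D : ℕ)
    (hf : ∀ x, {e | f e = x}.ncard ≤ D) (hg : ∀ y, {e | g e = y}.ncard ≤ D) :
    ∃ c : E → ℕ, (∀ e, c e < D) ∧
      (∀ e e', e ≠ e' → (f e = f e' ∨ g e = g e') → c e ≠ c e') := by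
  classical
  have := Fintype.ofFinite E
  obtain ⟨c, h1, h2⟩ := konig_finset (Finset.univ : Finset E) f g D
    (fun x => by
      have := hf x
      rwa [Set.ncard_eq_toFinset_card', Set.toFinset_ofPred] at this)
    (fun x => by
      have := hg x
      rwa [Set.ncard_eq_toFinset_card', Set.toFinset_ofPred] at this)
  exact ⟨c, fun e => h1 e (Finset.mem_univ _),
    fun e e' => h2 e (Finset.mem_univ _) e' (Finset.mem_univ _)⟩

end Konig

end FracPow

namespace FracPow

/-! ### From vertex states and edge fillings to colourings -/

section States

/-- Valid colours: `(l, i)` with `l < Δ`, `1 ≤ i ≤ k`, and the special colour `(0, 0)`. -/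
def Valid (Δ k : ℕ) (c : ℕ × ℕ) : Prop :=
  (c.1 < Δ ∧ 1 ≤ c.2 ∧ c.2 ≤ k) ∨ c = (0, 0)

/-- A state: an injective colouring of the ball of radius `k` around a branch vertex. -/
structure StOK (Δ k : ℕ) (S : ℕ → ℕ → ℕ × ℕ) : Prop where
  val : ∀ l i, l < Δ → i ≤ k → Valid Δ k (S l i)
  zero : ∀ l l', l < Δ → l' < Δ → S l 0 = S l' 0
  inj : ∀ l l' i j, l < Δ → l' < Δ → i ≤ k → j ≤ k → S l i = S l' j →
    (i = 0 ∧ j = 0) ∨ (l = l' ∧ i = j)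

/-- A filling of the `r` middle points of an edge compatible with the states at its ends. -/
structure EdgeOK (Δ k r : ℕ) (S T : ℕ → ℕ → ℕ × ℕ) (p q : ℕ) (mid : ℕ → ℕ × ℕ) : Prop where
  val : ∀ s, 1 ≤ s → s ≤ r → Valid Δ k (mid s)
  ends : ∀ i j, i ≤ k → j ≤ k → r + 1 ≤ i + j → S p i ≠ T q j
  left : ∀ l i s, l < Δ → i ≤ k → 1 ≤ s → s ≤ r → (i + s ≤ k ∨ (l = p ∧ s ≤ k + i)) → S l i ≠ mid s
  right : ∀ l i s, l < Δ → i ≤ k → 1 ≤ s → s ≤ r →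
    (i + (r + 1 - s) ≤ k ∨ (l = q ∧ r + 1 - s ≤ k + i)) → T l i ≠ mid s
  inj : ∀ s s', 1 ≤ s → s < s' → s' ≤ r → s' ≤ s + 2 * k → mid s ≠ mid s'
  far : ∀ l i j, l < Δ → i + r + 1 ≤ j → j ≤ k → S l i ≠ T q j ∧ T l i ≠ S p j

theorem EdgeOK.symm {Δ k r : ℕ} {S T : ℕ → ℕ → ℕ × ℕ} {p q : ℕ} {mid : ℕ → ℕ × ℕ}
    (H : EdgeOK Δ k r S T p q mid) : EdgeOK Δ k r T S q p (fun s => mid (r + 1 - s)) where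
  val s h1 h2 := H.val _ (by omega) (by omega)
  ends i j hi hj h := (H.ends j i hj hi (by omega)).symm
  left l i s hl hi h1 h2 h3 := H.right l i (r + 1 - s) hl hi (by omega) (by omega) (by omega)
  right l i s hl hi h1 h2 h3 := H.left l i (r + 1 - s) hl hi (by omega) (by omega) (by omega)
  inj s s' h1 h2 h3 h4 := (H.inj (r + 1 - s') (r + 1 - s) (by omega) (by omega) (by omega)
    (by omega)).symm
  far l i j hl h1 h2 := (H.far l i j hl h1 h2).symm

theorem exists_arm {V : Type*} (G : SimpleGraph V) (Δ k r : ℕ)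
    (idx : V → ℕ) (hidx : Function.Injective idx)
    (lab : V → V → ℕ) (hlab : ∀ u v, G.Adj u v → lab u v < Δ)
    (hinj : ∀ u v w, G.Adj u v → G.Adj u w → lab u v = lab u w → v = w)
    (st : V → ℕ → ℕ → ℕ × ℕ) (hst : ∀ u, StOK Δ k (st u))
    (hedge : ∀ u v, G.Adj u v → ∃ mid, EdgeOK Δ k r (st u) (st v) (lab u v) (lab v u) mid) :
    ∃ arm : V → V → ℕ → ℕ × ℕ, ArmOK G (2 * k) (2 * k + 1 + r) (Valid Δ k) arm := by
  classical
  have hedge' : ∀ u v, ∃ mid, G.Adj u v → EdgeOK Δ k r (st u) (st v) (lab u v) (lab v u) mid := by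
    intro u v
    by_cases h : G.Adj u v
    · obtain ⟨mid, hm⟩ := hedge u v h
      exact ⟨mid, fun _ => hm⟩
    · exact ⟨fun _ => (0, 0), fun h' => absurd h' h⟩
  choose mid0 hmid0 using hedge'
  let mid : V → V → ℕ → ℕ × ℕ := fun u v s =>
    if idx u < idx v then mid0 u v s else mid0 v u (r + 1 - s)
  have hmid : ∀ u v, G.Adj u v → EdgeOK Δ k r (st u) (st v) (lab u v) (lab v u) (mid u v) := by
    intro u v h
    by_cases hlt : idx u < idx v
    · have : mid u v = mid0 u v := by
        funext s
        simp only [mid, if_pos hlt]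
      rw [this]
      exact hmid0 u v h
    · have : mid u v = fun s => mid0 v u (r + 1 - s) := by
        funext s
        simp only [mid, if_neg hlt]
      rw [this]
      exact (hmid0 v u h.symm).symm
  have hsymm : ∀ u v, G.Adj u v → ∀ s, 1 ≤ s → s ≤ r → mid u v s = mid v u (r + 1 - s) := by
    intro u v h s h1 h2
    have : idx u ≠ idx v := fun h' => h.ne (hidx h')
    have h3 : r + 1 - (r + 1 - s) = s := by omega
    simp only [mid]
    split_ifs
    · omega
    · rw [h3]
    · rfl
    · omega
  let arm : V → V → ℕ → ℕ × ℕ := fun u v i =>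
    if i ≤ k then st u (lab u v) i
    else if i ≤ k + r then mid u v (i - k) else st v (lab v u) (2 * k + 1 + r - i)
  have harm : ∀ u v i, arm u v i = if i ≤ k then st u (lab u v) i
    else if i ≤ k + r then mid u v (i - k) else st v (lab v u) (2 * k + 1 + r - i) := fun _ _ _ => rfl
  have hstar : ∀ u v w, G.Adj u v → G.Adj u w → v ≠ w → ∀ i j, 1 ≤ i → 1 ≤ j → i + j ≤ 2 * k →
    i ≤ k → arm u v i ≠ arm u w j := by
    intro u v w h h' hvw i j hi hj hij hik
    have hl : lab u v ≠ lab u w := fun e => hvw (hinj u v w h h' e)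
    have hv := hlab u v h
    have hw := hlab u w h'
    have H := hmid u w h'
    rw [harm, harm, if_pos hik]
    split_ifs with h1 h2
    · intro e
      have := (hst u).inj _ _ _ _ hv hw hik h1 e
      omega
    · exact H.left _ _ _ hv hik (by omega) (by omega) (by omega)
    · exact (H.far _ _ _ hv (by omega) (by omega)).1
  refine ⟨arm, ?_, ?_, ?_, ?_, ?_⟩
  · intro u v h i hi
    rw [harm]
    split_ifs with h1 h2
    · exact (hst u).val _ _ (hlab u v h) h1
    · exact (hmid u v h).val _ (by omega) (by omega)
    · exact (hst v).val _ _ (hlab v u h.symm) (by omega)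
  · intro u v h i hi
    rw [harm, harm]
    split_ifs
    · omega
    · omega
    · congr 1
      omega
    · omega
    · rw [hsymm u v h _ (by omega) (by omega)]
      congr 1
      omega
    · omega
    · rfl
    · omega
    · omega
  · intro u v w h h'
    rw [harm, harm, if_pos (Nat.zero_le _), if_pos (Nat.zero_le _)]
    exact (hst u).zero _ _ (hlab u v h) (hlab u w h')
  · intro u v h i j hij hj hijk
    have H := hmid u v h
    have hl := hlab u v h
    have hl' := hlab v u h.symm
    rw [harm, harm]
    split_ifs with h1 h2 h3 h4 h5 h6 h7
    · intro e
      have := (hst u).inj _ _ _ _ hl hl h1 h2 e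
      omega
    · exact H.left _ _ _ hl h1 (by omega) (by omega) (Or.inr ⟨rfl, by omega⟩)
    · exact H.ends _ _ h1 (by omega) (by omega)
    · omega
    · exact H.inj _ _ (by omega) (by omega) (by omega) (by omega)
    · exact (H.right _ _ _ hl' (by omega) (by omega) (by omega) (Or.inr ⟨rfl, by omega⟩)).symm
    · omega
    · omega
    · intro e
      have := (hst v).inj _ _ _ _ hl' hl' (by omega) (by omega) e
      omega
  · intro u v w h h' hvw i j hi hj hij
    by_cases hik : i ≤ k
    · exact hstar u v w h h' hvw i j hi hj hij hik
    · exact (hstar u w v h' h hvw.symm j i hj hi (by omega) (by omega)).symm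

theorem colorable_of_arm {V : Type*} (G : SimpleGraph V) (Δ k m n : ℕ) (hΔ : 0 < Δ)
    (arm : V → V → ℕ → ℕ × ℕ) (H : ArmOK G m n (Valid Δ k) arm) (hmn : m < n)
    (hnb : ∀ u, ∃ v, G.Adj u v) :
    (fracPower G m n).Colorable (k * Δ + 1) := by
  obtain ⟨C⟩ := exists_coloring H hmn hnb
  let code : {x : ℕ × ℕ // Valid Δ k x} → Fin (k * Δ + 1) := fun x =>
    ⟨x.1.1 * k + x.1.2, by
      obtain ⟨⟨l, i⟩, h | h⟩ := x
      · dsimp only at h ⊢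
        have h2 : (l + 1) * k ≤ Δ * k := Nat.mul_le_mul_right k h.1
        nlinarith
      · simp only [Prod.mk.injEq] at h
        simp [h.1, h.2]⟩
  have hcode : Function.Injective code := by
    rintro ⟨⟨l, i⟩, h⟩ ⟨⟨l', i'⟩, h'⟩ heq
    have heq' : l * k + i = l' * k + i' := congrArg Fin.val heq
    rcases h with h | h <;> rcases h' with h' | h'
    · dsimp only at h h'
      rcases lt_trichotomy l l' with hl | hl | hl
      · have : (l + 1) * k ≤ l' * k := Nat.mul_le_mul_right k hl
        nlinarith
      · subst hl
        have : i = i' := by omega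
        subst this
        rfl
      · have : (l' + 1) * k ≤ l * k := Nat.mul_le_mul_right k hl
        nlinarith
    · simp only [Prod.mk.injEq] at h h'
      obtain ⟨rfl, rfl⟩ := h'
      omega
    · simp only [Prod.mk.injEq] at h h'
      obtain ⟨rfl, rfl⟩ := h
      omega
    · exact Subtype.ext (h.trans h'.symm)
  exact ⟨SimpleGraph.Coloring.mk (fun x => code (C x)) (fun h e => C.valid h (hcode e))⟩

/-- Summary: it suffices to provide states and edge fillings for every `0 ≤ r ≤ 2 k`. -/
theorem main_of_states {V : Type*} [Fintype V] (G : SimpleGraph V) [DecidableRel G.Adj]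
    [Nonempty V] (k n : ℕ) (hk : 1 ≤ k) (hkn : 2 * k < n) (hΔ : 0 < G.maxDegree)
    (hnb : ∀ u, ∃ v, G.Adj u v) (idx : V → ℕ) (hidx : Function.Injective idx)
    (H : ∀ r ≤ 2 * k, ∃ (lab : V → V → ℕ) (st : V → ℕ → ℕ → ℕ × ℕ),
      (∀ u v, G.Adj u v → lab u v < G.maxDegree) ∧
      (∀ u v w, G.Adj u v → G.Adj u w → lab u v = lab u w → v = w) ∧
      (∀ u, StOK G.maxDegree k (st u)) ∧
      (∀ u v, G.Adj u v →
        ∃ mid, EdgeOK G.maxDegree k r (st u) (st v) (lab u v) (lab v u) mid)) :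
    (fracPower G (2 * k) n).chromaticNumber = (fracPower G (2 * k) n).cliqueNum := by
  obtain ⟨lab, st, h1, h2, h3, h4⟩ := H ((n - (2 * k + 1)) % (2 * k + 1))
    (Nat.lt_succ_iff.1 (Nat.mod_lt _ (by omega)))
  have harm := exists_arm G _ k _ idx hidx lab h1 h2 st h3 h4
  have harm2 := ArmOK.extend_many (by omega) idx hidx harm ((n - (2 * k + 1)) / (2 * k + 1))
  have hn : 2 * k + 1 + (n - (2 * k + 1)) % (2 * k + 1) +
      (2 * k + 1) * ((n - (2 * k + 1)) / (2 * k + 1)) = n := by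
    have := Nat.mod_add_div (n - (2 * k + 1)) (2 * k + 1)
    omega
  rw [hn] at harm2
  obtain ⟨arm, harm2⟩ := harm2
  have hcol := colorable_of_arm G _ k _ n hΔ arm harm2 hkn hnb
  apply le_antisymm
  · refine hcol.chromaticNumber_le.trans ?_
    exact_mod_cast le_cliqueNum G k n hk hkn
  · exact SimpleGraph.cliqueNum_le_chromaticNumber

end States

end FracPow

namespace FracPow

section CaseFour

/-- The standard state. -/
def st0 (l i : ℕ) : ℕ × ℕ := if i = 0 then (0, 0) else (l, i)

theorem st0_ok (Δ k : ℕ) : StOK Δ k st0 where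
  val l i hl hi := by
    unfold Valid st0
    split_ifs with h
    · exact Or.inr rfl
    · exact Or.inl ⟨hl, by dsimp only; omega, hi⟩
  zero l l' _ _ := rfl
  inj l l' i j hl hl' hi hj h := by
    unfold st0 at h
    split_ifs at h <;> simp only [Prod.mk.injEq] at h <;> omega

theorem edge_four (Δ k r p q t t' : ℕ) (hr : r ≤ 2 * k) (hpq : p ≠ q) 
    (htp : t ≠ p) (htq : t ≠ q) (htp' : t' ≠ p) (htq' : t' ≠ q) (htt : t ≠ t')
    (ht : t < Δ) (ht' : t' < Δ) :
    EdgeOK Δ k r st0 st0 p q (fun s => if s ≤ r + 1 - s then (t, k + 1 - s) else (t', k + s - r)) where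
  val s h1 h2 := by
    unfold Valid
    left
    split_ifs
    · exact ⟨ht, by dsimp only; omega, by dsimp only; omega⟩
    · exact ⟨ht', by dsimp only; omega, by dsimp only; omega⟩
  ends i j hi hj h := by
    unfold st0
    split_ifs <;> simp only [ne_eq, Prod.mk.injEq] <;> omega
  left l i s hl hi h1 h2 h3 := by
    unfold st0
    split_ifs <;> simp only [ne_eq, Prod.mk.injEq] <;> omega
  right l i s hl hi h1 h2 h3 := by
    unfold st0
    split_ifs <;> simp only [ne_eq, Prod.mk.injEq] <;> omega
  inj s s' h1 h2 h3 h4 := by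
    split_ifs <;> simp only [ne_eq, Prod.mk.injEq] <;> omega
  far l i j hl h1 h2 := by
    unfold st0
    constructor <;> split_ifs <;> simp only [ne_eq, Prod.mk.injEq] <;> omega

theorem exists_two (Δ p q : ℕ) (hΔ : 4 ≤ Δ) :
    ∃ t t', t ≠ p ∧ t ≠ q ∧ t' ≠ p ∧ t' ≠ q ∧ t ≠ t' ∧ t < Δ ∧ t' < Δ := by
  have h : 1 < ((Finset.range 4).filter (fun x => x ≠ p ∧ x ≠ q)).card := by
    have h1 : (Finset.range 4) ⊆ ((Finset.range 4).filter (fun x => x ≠ p ∧ x ≠ q)) ∪ {p, q} := by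
      intro x hx
      simp only [Finset.mem_union, Finset.mem_filter, Finset.mem_insert, Finset.mem_singleton]
      tauto
    have h2 := (Finset.card_le_card h1).trans (Finset.card_union_le _ _)
    have h3 : ({p, q} : Finset ℕ).card ≤ 2 := Finset.card_le_two
    rw [Finset.card_range] at h2
    omega
  obtain ⟨t, ht, t', ht', hne⟩ := Finset.one_lt_card.1 h
  simp only [Finset.mem_filter, Finset.mem_range] at ht ht'
  exact ⟨t, t', ht.2.1, ht.2.2, ht'.2.1, ht'.2.2, hne, by omega, by omega⟩

/-- Labels at the ends of edges, different at the two ends of each edge. -/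
theorem exists_labels_four {V : Type*} [Fintype V] (G : SimpleGraph V) [DecidableRel G.Adj]
    (hΔ : 2 ≤ G.maxDegree) : ∃ lab : V → V → ℕ,
      (∀ u v, G.Adj u v → lab u v < G.maxDegree) ∧
      (∀ u v w, G.Adj u v → G.Adj u w → lab u v = lab u w → v = w) ∧
      (∀ u v, G.Adj u v → lab u v ≠ lab v u) := by
  classical
  obtain ⟨c, h1, h2⟩ := konig (E := G.Dart) (fun d => d.fst) (fun d => d.edge) G.maxDegree
    (by
      intro x
      rw [Set.ncard_eq_toFinset_card', Set.toFinset_ofPred, G.dart_fst_fiber_card_eq_degree]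
      exact G.degree_le_maxDegree x)
    (by
      intro e
      by_cases he : ∃ d : G.Dart, d.edge = e
      · obtain ⟨d, rfl⟩ := he
        rw [Set.ncard_eq_toFinset_card', Set.toFinset_ofPred, G.dart_edge_fiber_card _ d.edge_mem]
        exact hΔ
      · have : {d : G.Dart | d.edge = e} = ∅ := by
          ext d
          simp only [Set.mem_ofPred_eq, Set.mem_empty_iff_false, iff_false]
          exact fun h => he ⟨d, h⟩
        rw [this, Set.ncard_empty]
        omega)
  refine ⟨fun u v => if h : G.Adj u v then c ⟨(u, v), h⟩ else 0, ?_, ?_, ?_⟩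
  · intro u v h
    beta_reduce
    rw [dif_pos h]
    exact h1 _
  · intro u v w h h' e
    beta_reduce at e
    rw [dif_pos h, dif_pos h'] at e
    by_contra hne
    refine h2 ⟨(u, v), h⟩ ⟨(u, w), h'⟩ ?_ (Or.inl rfl) e
    intro h3
    rw [SimpleGraph.Dart.mk.injEq, Prod.mk.injEq] at h3
    exact hne h3.2
  · intro u v h
    beta_reduce
    rw [dif_pos h, dif_pos h.symm]
    refine h2 _ _ ?_ (Or.inr ?_)
    · intro h3
      rw [SimpleGraph.Dart.mk.injEq, Prod.mk.injEq] at h3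
      exact h.ne h3.1
    · exact Sym2.eq_swap

theorem case_four {V : Type*} [Fintype V] (G : SimpleGraph V) [DecidableRel G.Adj]
    (hΔ : 4 ≤ G.maxDegree) (k r : ℕ) (hr : r ≤ 2 * k) :
    ∃ (lab : V → V → ℕ) (st : V → ℕ → ℕ → ℕ × ℕ),
      (∀ u v, G.Adj u v → lab u v < G.maxDegree) ∧
      (∀ u v w, G.Adj u v → G.Adj u w → lab u v = lab u w → v = w) ∧
      (∀ u, StOK G.maxDegree k (st u)) ∧
      (∀ u v, G.Adj u v →
        ∃ mid, EdgeOK G.maxDegree k r (st u) (st v) (lab u v) (lab v u) mid) := by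
  obtain ⟨lab, h1, h2, h3⟩ := exists_labels_four G (by omega)
  refine ⟨lab, fun _ => st0, h1, h2, fun _ => st0_ok _ _, ?_⟩
  intro u v h
  obtain ⟨t, t', a1, a2, a3, a4, a5, a6, a7⟩ := exists_two G.maxDegree (lab u v) (lab v u) hΔ
  exact ⟨_, edge_four _ k r _ _ t t' hr (h3 u v h) a1 a2 a3 a4 a5 a6 a7⟩

end CaseFour

end FracPow

namespace FracPow

/-! ### The structure theorem for subcubic graphs -/

section Cubic

open Finset in
theorem bad_count {V : Type*} [Fintype V] [DecidableEq V] (G : SimpleGraph V) [DecidableRel G.Adj]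
    (s : V → Bool) (u : V) :
    (univ.filter (fun p : V × V => G.Adj p.1 p.2 ∧ s p.1 = s p.2)).card =
    (univ.filter (fun p : V × V => (G.Adj p.1 p.2 ∧ s p.1 = s p.2) ∧ (p.1 ≠ u ∧ p.2 ≠ u))).card +
    2 * ((univ.filter (fun v => G.Adj u v ∧ s u = s v)).card) := by
  rw [← Finset.card_filter_add_card_filter_not (s := univ.filter
    (fun p : V × V => G.Adj p.1 p.2 ∧ s p.1 = s p.2)) (fun p => p.1 ≠ u ∧ p.2 ≠ u)]
  rw [Finset.filter_filter, Finset.filter_filter]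
  congr 1
  have h : (univ.filter (fun p : V × V => (G.Adj p.1 p.2 ∧ s p.1 = s p.2) ∧ ¬ (p.1 ≠ u ∧ p.2 ≠ u))) =
      ((univ.filter (fun v => G.Adj u v ∧ s u = s v)).image (fun v => (u, v))) ∪
      ((univ.filter (fun v => G.Adj u v ∧ s u = s v)).image (fun v => (v, u))) := by
    ext ⟨x, y⟩
    simp only [mem_filter, mem_univ, true_and, mem_union, mem_image, Prod.mk.injEq]
    constructor
    · rintro ⟨⟨h1, h2⟩, h3⟩
      by_cases hx : x = u
      · subst hx
        exact Or.inl ⟨y, ⟨h1, h2⟩, rfl, rfl⟩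
      · have hy : y = u := by tauto
        subst hy
        exact Or.inr ⟨x, ⟨h1.symm, h2.symm⟩, rfl, rfl⟩
    · rintro (⟨v, ⟨h1, h2⟩, rfl, rfl⟩ | ⟨v, ⟨h1, h2⟩, rfl, rfl⟩)
      · exact ⟨⟨h1, h2⟩, by tauto⟩
      · exact ⟨⟨h1.symm, h2.symm⟩, by tauto⟩
  rw [h, Finset.card_union_of_disjoint, Finset.card_image_of_injective, Finset.card_image_of_injective,
    two_mul]
  · intro a b hab
    exact (Prod.mk.inj hab).1
  · intro a b hab
    exact (Prod.mk.inj hab).2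
  · rw [Finset.disjoint_left]
    rintro ⟨x, y⟩ h1 h2
    simp only [mem_filter, mem_univ, true_and, mem_image, Prod.mk.injEq] at h1 h2
    obtain ⟨v, ⟨h3, _⟩, rfl, rfl⟩ := h1
    obtain ⟨w, ⟨h4, _⟩, h5, h6⟩ := h2
    exact h3.ne h6

open Finset in
theorem exists_cut {V : Type*} [Fintype V] (G : SimpleGraph V) [DecidableRel G.Adj]
    (hdeg : ∀ u, G.degree u ≤ 3) : ∃ side : V → Bool,
    ∀ u v w, G.Adj u v → G.Adj u w → side u = side v → side u = side w → v = w := by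
  classical
  obtain ⟨s, hs⟩ := Finite.exists_min (fun s : V → Bool =>
    (univ.filter (fun p : V × V => G.Adj p.1 p.2 ∧ s p.1 = s p.2)).card)
  refine ⟨s, ?_⟩
  intro u v w hv hw hsv hsw
  by_contra hne
  let s' : V → Bool := fun x => if x = u then !(s u) else s x
  have h1 := bad_count G s u
  have h2 := bad_count G s' u
  have h3 := hs s'
  have h4 : (univ.filter (fun p : V × V => (G.Adj p.1 p.2 ∧ s' p.1 = s' p.2) ∧
      (p.1 ≠ u ∧ p.2 ≠ u))) =
      (univ.filter (fun p : V × V => (G.Adj p.1 p.2 ∧ s p.1 = s p.2) ∧ (p.1 ≠ u ∧ p.2 ≠ u))) := by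
    apply Finset.filter_congr
    rintro ⟨x, y⟩ -
    simp only [s']
    constructor
    · rintro ⟨⟨h5, h6⟩, h7, h8⟩
      rw [if_neg h7, if_neg h8] at h6
      exact ⟨⟨h5, h6⟩, h7, h8⟩
    · rintro ⟨⟨h5, h6⟩, h7, h8⟩
      rw [if_neg h7, if_neg h8]
      exact ⟨⟨h5, h6⟩, h7, h8⟩
  have h5 : (univ.filter (fun v => G.Adj u v ∧ s' u = s' v)) =
      (univ.filter (fun v => G.Adj u v ∧ ¬ s u = s v)) := by
    apply Finset.filter_congr
    intro x _
    simp only [s', if_true]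
    constructor
    · rintro ⟨h6, h7⟩
      rw [if_neg h6.ne.symm] at h7
      exact ⟨h6, by cases h : s u <;> cases h' : s x <;> simp_all⟩
    · rintro ⟨h6, h7⟩
      rw [if_neg h6.ne.symm]
      exact ⟨h6, by cases h : s u <;> cases h' : s x <;> simp_all⟩
  have h6 : (univ.filter (fun v => G.Adj u v ∧ s u = s v)).card +
      (univ.filter (fun v => G.Adj u v ∧ ¬ s u = s v)).card ≤ 3 := by
    rw [← Finset.filter_filter, ← Finset.filter_filter,
      Finset.card_filter_add_card_filter_not, ← G.neighborFinset_eq_filter]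
    exact hdeg u
  have h7 : 2 ≤ (univ.filter (fun v => G.Adj u v ∧ s u = s v)).card := by
    have : ({v, w} : Finset V) ⊆ univ.filter (fun v => G.Adj u v ∧ s u = s v) := by
      intro x hx
      simp only [mem_insert, mem_singleton] at hx
      rw [mem_filter]
      rcases hx with rfl | rfl
      · exact ⟨mem_univ _, hv, hsv⟩
      · exact ⟨mem_univ _, hw, hsw⟩
    have h8 := Finset.card_le_card this
    rwa [Finset.card_pair hne] at h8
  rw [h4, h5] at h2
  omega

theorem exists_pairing {V : Type*} (M : V → V → Prop) (hsymm : ∀ u v, M u v → M v u)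
    (huniq : ∀ u v w, M u v → M u w → v = w) :
    ∃ f : V → Sym2 V, (∀ u, u ∈ f u) ∧ ∀ u v, M u v → f u = f v := by
  classical
  let f : V → Sym2 V := fun u => if h : ∃ v, M u v then s(u, h.choose) else s(u, u)
  have hf : ∀ u v, M u v → f u = s(u, v) := by
    intro u v h
    have h' : ∃ v, M u v := ⟨v, h⟩
    simp only [f, dif_pos h']
    rw [huniq u _ v h'.choose_spec h]
  refine ⟨f, ?_, ?_⟩
  · intro u
    simp only [f]
    split_ifs <;> simp
  · intro u v h
    rw [hf u v h, hf v u (hsymm _ _ h), Sym2.eq_swap]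

theorem ncard_fiber_le {V : Type*} (f : V → Sym2 V) (hf : ∀ u, u ∈ f u) (e : Sym2 V) :
    {u | f u = e}.ncard ≤ 2 := by
  induction e using Sym2.ind with
  | _ a b =>
    refine le_trans (Set.ncard_le_ncard (t := {a, b}) ?_ (by simp)) ?_
    · intro u hu
      have h := hf u
      rw [show f u = s(a, b) from hu, Sym2.mem_iff] at h
      simpa using h
    · exact Set.ncard_insert_le _ _ |>.trans (by simp)

theorem two_matchings {V : Type*} [Finite V] (M N : V → V → Prop)
    (hM : ∀ u v, M u v → M v u) (hM' : ∀ u v w, M u v → M u w → v = w) (hMi : ∀ u, ¬ M u u)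
    (hN : ∀ u v, N u v → N v u) (hN' : ∀ u v w, N u v → N u w → v = w) (hNi : ∀ u, ¬ N u u) :
    ∃ ε : V → Bool, (∀ u v, M u v → ε u ≠ ε v) ∧ (∀ u v, N u v → ε u ≠ ε v) := by
  obtain ⟨f, hf1, hf2⟩ := exists_pairing M hM hM'
  obtain ⟨g, hg1, hg2⟩ := exists_pairing N hN hN'
  obtain ⟨c, hc1, hc2⟩ := konig f g 2 (ncard_fiber_le f hf1) (ncard_fiber_le g hg1)
  refine ⟨fun u => decide (c u = 0), ?_, ?_⟩
  · intro u v h e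
    have h1 := hc1 u
    have h2 := hc1 v
    have h3 : u ≠ v := by
      rintro rfl
      exact hMi u h
    have h4 := hc2 u v h3 (Or.inl (hf2 u v h))
    simp only [decide_eq_decide] at e
    omega
  · intro u v h e
    have h1 := hc1 u
    have h2 := hc1 v
    have h3 : u ≠ v := by
      rintro rfl
      exact hNi u h
    have h4 := hc2 u v h3 (Or.inr (hg2 u v h))
    simp only [decide_eq_decide] at e
    omega

open Finset in
theorem exists_cubic_labels {V : Type*} [Fintype V] (G : SimpleGraph V) [DecidableRel G.Adj]
    (hdeg : ∀ u, G.degree u ≤ 3) (side : V → Bool) :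
    ∃ d : V → V → ℕ, (∀ u v, G.Adj u v → d u v < 3) ∧
      (∀ u v w, G.Adj u v → G.Adj u w → d u v = d u w → v = w) ∧
      (∀ u v, G.Adj u v → side u ≠ side v → d u v = d v u) ∧
      (∀ u v, G.Adj u v → side u = side v → d u v ≠ d v u) := by
  classical
  let T : Finset (V × V) := univ.filter
    (fun p => G.Adj p.1 p.2 ∧ ¬ (side p.1 = false ∧ side p.2 = true))
  let f : V × V → V ⊕ Sym2 V := fun p => if side p.1 = true then Sum.inl p.1 else Sum.inr s(p.1, p.2)
  let g : V × V → V ⊕ Sym2 V := fun p =>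
    if side p.1 = true then (if side p.2 = true then Sum.inr s(p.1, p.2) else Sum.inl p.2)
    else Sum.inl p.1
  have hpair : ∀ (a b : V) (U : Finset (V × V)), (∀ p ∈ U, s(p.1, p.2) = s(a, b)) → U.card ≤ 3 := by
    intro a b U hU
    have : U ⊆ {(a, b), (b, a)} := by
      rintro ⟨x, y⟩ hp
      have := hU _ hp
      rw [Sym2.eq_iff] at this
      simp only [mem_insert, mem_singleton, Prod.mk.injEq]
      exact this
    exact (Finset.card_le_card this).trans (Finset.card_le_two.trans (by norm_num))
  obtain ⟨c, hc1, hc2⟩ := konig_finset T f g 3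
    (by
      rintro (u | e)
      · have : T.filter (fun p => f p = Sum.inl u) ⊆ (G.neighborFinset u).image (fun v => (u, v)) := by
          rintro ⟨x, y⟩ hp
          simp only [T, f, mem_filter, mem_univ, true_and] at hp
          obtain ⟨⟨h1, h2⟩, h3⟩ := hp
          split_ifs at h3 with h4
          · simp only [Sum.inl.injEq] at h3
            subst h3
            exact mem_image.2 ⟨y, by simpa using h1, rfl⟩
        exact (Finset.card_le_card this).trans (Finset.card_image_le.trans (hdeg u))
      · induction e using Sym2.ind with
        | _ a b =>
          apply hpair a b
          rintro ⟨x, y⟩ hp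
          simp only [f, mem_filter] at hp
          obtain ⟨_, h3⟩ := hp
          split_ifs at h3 with h4
          exact Sum.inr.inj h3)
    (by
      rintro (u | e)
      · have : T.filter (fun p => g p = Sum.inl u) ⊆ (G.neighborFinset u).image
            (fun v => if side v = true then (v, u) else (u, v)) := by
          rintro ⟨x, y⟩ hp
          simp only [T, g, mem_filter, mem_univ, true_and] at hp
          obtain ⟨⟨h1, h2⟩, h3⟩ := hp
          split_ifs at h3 with h4 h5
          · simp only [Sum.inl.injEq] at h3
            subst h3
            exact mem_image.2 ⟨x, by simpa using h1.symm, by simp [h4]⟩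
          · simp only [Sum.inl.injEq] at h3
            subst h3
            exact mem_image.2 ⟨y, by simpa using h1, by
              have : ¬ side y = true := fun h => h2 ⟨by simpa using h4, h⟩
              rw [if_neg this]⟩
        exact (Finset.card_le_card this).trans (Finset.card_image_le.trans (hdeg u))
      · induction e using Sym2.ind with
        | _ a b =>
          apply hpair a b
          rintro ⟨x, y⟩ hp
          simp only [g, mem_filter] at hp
          obtain ⟨_, h3⟩ := hp
          split_ifs at h3 with h4
          exact Sum.inr.inj h3)
  let D : V → V → V × V := fun u v => if side u = false ∧ side v = true then (v, u) else (u, v)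
  have hDT : ∀ u v, G.Adj u v → D u v ∈ T := by
    intro u v h
    simp only [D, T, mem_filter, mem_univ, true_and]
    split_ifs with h1
    · exact ⟨h.symm, by simp [h1]⟩
    · exact ⟨h, h1⟩
  have hDe : ∀ u v, s((D u v).1, (D u v).2) = s(u, v) := by
    intro u v
    simp only [D]
    split_ifs
    · exact Sym2.eq_swap
    · rfl
  have hDf : ∀ u v, side u = true → f (D u v) = Sum.inl u := by
    intro u v h
    simp [D, f, h]
  have hDg : ∀ u v, side u = false → g (D u v) = Sum.inl u := by
    intro u v h
    cases h' : side v <;> simp [D, g, h, h']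
  refine ⟨fun u v => c (D u v), ?_, ?_, ?_, ?_⟩
  · intro u v h
    exact hc1 _ (hDT u v h)
  · intro u v w h h' e
    by_contra hne
    refine hc2 _ (hDT u v h) _ (hDT u w h') ?_ ?_ e
    · intro h1
      have h2 := hDe u v
      rw [h1, hDe u w, Sym2.eq_iff] at h2
      rcases h2 with h2 | h2
      · exact hne h2.2.symm
      · exact h.ne h2.1
    · cases hs : side u
      · exact Or.inr ((hDg u v hs).trans (hDg u w hs).symm)
      · exact Or.inl ((hDf u v hs).trans (hDf u w hs).symm)
  · intro u v h hs
    have hD : D u v = D v u := by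
      simp only [D]
      cases h1 : side u <;> cases h2 : side v <;> simp
      · exact absurd (h1.trans h2.symm) hs
      · exact absurd (h1.trans h2.symm) hs
    exact congrArg c hD
  · intro u v h hs
    have hD1 : D u v = (u, v) := by
      simp only [D]
      rw [if_neg]
      rintro ⟨h1, h2⟩
      simp_all
    have hD2 : D v u = (v, u) := by
      simp only [D]
      rw [if_neg]
      rintro ⟨h1, h2⟩
      simp_all
    refine hc2 _ (hDT u v h) _ (hDT v u h.symm) ?_ ?_
    · rw [hD1, hD2]
      intro h1
      exact h.ne (Prod.mk.inj h1).1
    · rw [hD1, hD2]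
      cases h1 : side u
      · left
        have h2 : side v = false := by rw [← hs, h1]
        simp only [f, h1, h2]
        simp [Sym2.eq_swap]
      · right
        have h2 : side v = true := by rw [← hs, h1]
        simp only [g, h1, h2]
        simp [Sym2.eq_swap]

theorem exists_structure {V : Type*} [Fintype V] (G : SimpleGraph V) [DecidableRel G.Adj]
    (hdeg : ∀ u, G.degree u ≤ 3) :
    ∃ (side : V → Bool) (d : V → V → ℕ) (ε : V → ℕ → Bool),
      (∀ u v, G.Adj u v → d u v < 3) ∧
      (∀ u v w, G.Adj u v → G.Adj u w → d u v = d u w → v = w) ∧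
      (∀ u v w, G.Adj u v → G.Adj u w → side u = side v → side u = side w → v = w) ∧
      (∀ u v, G.Adj u v → side u ≠ side v → d u v = d v u ∧ ε u (d u v) ≠ ε v (d u v)) ∧
      (∀ u v, G.Adj u v → side u = side v → d u v ≠ d v u ∧ ∀ l, ε u l ≠ ε v l) := by
  obtain ⟨side, hside⟩ := exists_cut G hdeg
  obtain ⟨d, hd1, hd2, hd3, hd4⟩ := exists_cubic_labels G hdeg side
  have hε : ∀ l : ℕ, ∃ ε : V → Bool,
      (∀ u v, (G.Adj u v ∧ side u ≠ side v ∧ d u v = l) → ε u ≠ ε v) ∧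
      (∀ u v, (G.Adj u v ∧ side u = side v) → ε u ≠ ε v) := by
    intro l
    refine two_matchings (fun u v => G.Adj u v ∧ side u ≠ side v ∧ d u v = l)
      (fun u v => G.Adj u v ∧ side u = side v) ?_ ?_ ?_ ?_ ?_ ?_
    · rintro u v ⟨h1, h2, h3⟩
      exact ⟨h1.symm, h2.symm, by rw [← hd3 u v h1 h2, h3]⟩
    · rintro u v w ⟨h1, _, h3⟩ ⟨h4, _, h6⟩
      exact hd2 u v w h1 h4 (h3.trans h6.symm)
    · rintro u ⟨h1, _⟩
      exact h1.ne rfl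
    · rintro u v ⟨h1, h2⟩
      exact ⟨h1.symm, h2.symm⟩
    · rintro u v w ⟨h1, h2⟩ ⟨h3, h4⟩
      exact hside u v w h1 h3 h2 h4
    · rintro u ⟨h1, _⟩
      exact h1.ne rfl
  choose ε hε1 hε2 using hε
  refine ⟨side, d, fun u l => ε l u, hd1, hd2, hside, ?_, ?_⟩
  · intro u v h hs
    exact ⟨hd3 u v h hs, hε1 _ u v ⟨h, hs, rfl⟩⟩
  · intro u v h hs
    exact ⟨hd4 u v h hs, fun l => hε2 l u v ⟨h, hs⟩⟩

end Cubic

end FracPow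

namespace FracPow

section CaseThreeShort

/-- States for the case `Δ = 3`, `r ≤ k`. -/
def stF (k r : ℕ) (ε : ℕ → Bool) (l i : ℕ) : ℕ × ℕ :=
  if i = 0 then (0, 0) else if i + r ≤ k then (l, i)
  else if ε l = true then (l, i) else (l, 2 * k - r + 1 - i)

theorem stF_ok (Δ k r : ℕ) (hr : r ≤ k) (ε : ℕ → Bool) : StOK Δ k (stF k r ε) where
  val l i hl hi := by
    unfold Valid stF
    split_ifs with h
    · exact Or.inr rfl
    all_goals exact Or.inl ⟨hl, by dsimp only; omega, by dsimp only; omega⟩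
  zero l l' _ _ := rfl
  inj l l' i j hl hl' hi hj h := by
    unfold stF at h
    by_cases hll : l = l'
    · subst hll
      split_ifs at h <;> simp only [Prod.mk.injEq] at h <;> omega
    · split_ifs at h <;> simp only [Prod.mk.injEq] at h <;> omega

theorem edge_three_short (k r p q t : ℕ) (hr : r ≤ k) (hpq : p ≠ q)
    (htp : t ≠ p) (htq : t ≠ q) (ht : t < 3)
    (ε η : ℕ → Bool) (h : ε t ≠ η t) :
    EdgeOK 3 k r (stF k r ε) (stF k r η) p q (fun s => stF k r ε t (k + 1 - s)) where
  val s h1 h2 := (stF_ok 3 k r hr ε).val _ _ ht (by omega)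
  ends i j hi hj h := by
    unfold stF
    split_ifs <;> simp only [ne_eq, Prod.mk.injEq] <;> omega
  left l i s hl hi h1 h2 h3 := by
    intro e
    have := (stF_ok 3 k r hr ε).inj _ _ _ _ hl ht hi (by omega) e
    omega
  right l i s hl hi h1 h2 h3 := by
    have h4 : stF k r ε t (k + 1 - s) = stF k r η t (k - r + s) := by
      unfold stF
      cases hh : ε t <;> cases hh' : η t
      · simp_all
      · split_ifs <;> simp only [Prod.mk.injEq] <;> simp_all <;> omega
      · split_ifs <;> simp only [Prod.mk.injEq] <;> simp_all <;> omega
      · simp_all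
    rw [h4]
    intro e
    have := (stF_ok 3 k r hr η).inj _ _ _ _ hl ht hi (by omega) e
    omega
  inj s s' h1 h2 h3 h4 := by
    intro e
    have := (stF_ok 3 k r hr ε).inj _ _ _ _ ht ht (by omega) (by omega) e
    omega
  far l i j hl h1 h2 := by
    unfold stF
    constructor <;> split_ifs <;> simp only [ne_eq, Prod.mk.injEq] <;> omega

theorem case_three_short {V : Type*} [Fintype V] (G : SimpleGraph V) [DecidableRel G.Adj]
    (hΔ : G.maxDegree = 3) (k r : ℕ) (hr : r ≤ k) :
    ∃ (lab : V → V → ℕ) (st : V → ℕ → ℕ → ℕ × ℕ),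
      (∀ u v, G.Adj u v → lab u v < G.maxDegree) ∧
      (∀ u v w, G.Adj u v → G.Adj u w → lab u v = lab u w → v = w) ∧
      (∀ u, StOK G.maxDegree k (st u)) ∧
      (∀ u v, G.Adj u v →
        ∃ mid, EdgeOK G.maxDegree k r (st u) (st v) (lab u v) (lab v u) mid) := by
  rw [hΔ]
  obtain ⟨side, d, ε, hd1, hd2, _, hd3, hd4⟩ := exists_structure G
    (fun u => hΔ ▸ G.degree_le_maxDegree u)
  refine ⟨fun u v => (d u v + (if side u = true then 1 else 0)) % 3,
    fun u => stF k r (fun l => ε u ((l + 1) % 3)), ?_, ?_, fun u => stF_ok _ _ _ hr _, ?_⟩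
  · intro u v _
    exact Nat.mod_lt _ (by norm_num)
  · intro u v w h h' e
    have h1 := hd1 u v h
    have h2 := hd1 u w h'
    refine hd2 u v w h h' ?_
    dsimp only at e
    omega
  · intro u v h
    have h1 := hd1 u v h
    have h2 := hd1 v u h.symm
    beta_reduce
    generalize hp : (d u v + (if side u = true then 1 else 0)) % 3 = p
    generalize hq : (d v u + (if side v = true then 1 else 0)) % 3 = q
    by_cases hs : side u = side v
    · obtain ⟨h3, h4⟩ := hd4 u v h hs
      rw [hs] at hp
      exact ⟨_, edge_three_short k r p q (3 - p - q) hr (by omega) (by omega) (by omega)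
        (by omega) _ _ (h4 _)⟩
    · obtain ⟨h3, h4⟩ := hd3 u v h hs
      have h5 : (if side u = true then 1 else 0) + (if side v = true then 1 else 0) = 1 := by
        cases h6 : side u <;> cases h7 : side v <;> simp_all
      generalize (if side u = true then 1 else 0) = x at *
      generalize (if side v = true then 1 else 0) = y at *
      have hp3 : p < 3 := by omega
      have hq3 : q < 3 := by omega
      have hpq : p ≠ q := by omega
      have h6 : (3 - p - q + 1) % 3 = d u v := by omega
      clear hp hq
      refine ⟨_, edge_three_short k r p q (3 - p - q) hr hpq (by omega) (by omega)
        (by omega) _ _ ?_⟩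
      rw [h6]
      exact h4

end CaseThreeShort

end FracPow

namespace FracPow

section CaseThreeLong

/-- States for the case `Δ = 3`, `r > k`. The parameter `m` is the label of the modified chain
(`m = 3` if there is none), `z` the position of the special colour on this chain. -/
def stG (k z : ℕ) (ε : ℕ → Bool) (m l i : ℕ) : ℕ × ℕ :=
  if i = 0 then
    if m < 3 then (m, if ε m = true then 1 else k) else (0, 0)
  else if l = m then
    if i < z then (m, if ε m = true then i + 1 else k - i)
    else if i = z then (0, 0)
    else (m, if ε m = true then i else k + 1 - i)
  else (l, if ε l = true then i else k + 1 - i)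

theorem stG_ok (k z : ℕ) (hz1 : 1 ≤ z) (hzk : z ≤ k) (ε : ℕ → Bool) (m : ℕ) :
    StOK 3 k (stG k z ε m) where
  val l i hl hi := by
    unfold Valid stG
    split_ifs <;>
      first
      | exact Or.inr rfl
      | exact Or.inl ⟨by show (_ : ℕ) < 3; omega, by show 1 ≤ (_ : ℕ); omega, by show (_ : ℕ) ≤ k; omega⟩
  zero l l' _ _ := rfl
  inj l l' i j hl hl' hi hj h := by
    unfold stG at h
    by_cases hll : l = l'
    · subst hll
      split_ifs at h <;> simp only [Prod.mk.injEq] at h <;> omega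
    · by_cases hm : l' = m
      · subst hm
        split_ifs at h <;> simp only [Prod.mk.injEq] at h <;> omega
      · split_ifs at h <;> simp only [Prod.mk.injEq] at h <;> omega

/-- The possible values of `z`. -/
def ZOK (k e z : ℕ) : Prop := (z = k ∧ (2 ≤ e ∨ k = 1)) ∨ (z = k / 2 ∧ e = 1 ∧ 2 ≤ k)

set_option maxHeartbeats 2000000 in
theorem edge_cross_one (k e z l a b mu mv : ℕ) (he : 1 ≤ e) (hek : e ≤ k) (hz : ZOK k e z)
    (hl : l < 3) (ha : a < 3) (hb : b < 3) (hla : l ≠ a) (hlb : l ≠ b) (hab : a ≠ b)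
    (hm : (mu = 3 ∧ mv = 3) ∨ (mu = a ∧ mv = 3) ∨ (mu = a ∧ mv = a))
    (ε η : ℕ → Bool) (h : ε l ≠ η l) :
    EdgeOK 3 k (k + e) (stG k z ε mu) (stG k z η mv) l l
      (fun s => if s ≤ (k + e) / 2 then stG k z ε mu a (k + 1 - s)
        else stG k z η mv b (k + 1 - (k + e + 1 - s))) := by
  have hz1 : 1 ≤ z := by unfold ZOK at hz; omega
  have hzk : z ≤ k := by unfold ZOK at hz; omega
  have hS := stG_ok k z hz1 hzk ε mu
  have hT := stG_ok k z hz1 hzk η mv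
  refine ⟨?_, ?_, ?_, ?_, ?_, ?_⟩
  · intro s h1 h2
    split_ifs
    · exact hS.val _ _ ha (by omega)
    · exact hT.val _ _ hb (by omega)
  · intro i j hi hj hij
    have h1 : l ≠ mu := by omega
    have h2 : l ≠ mv := by omega
    have h3 : i ≠ 0 := by omega
    have h4 : j ≠ 0 := by omega
    unfold stG
    rw [if_neg h3, if_neg h1, if_neg h4, if_neg h2]
    cases h5 : ε l <;> cases h6 : η l <;> simp_all <;> omega
  · intro L i s hL hi h1 h2 h3
    split_ifs with h4
    · intro E
      have := hS.inj _ _ _ _ hL ha hi (by omega) E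
      omega
    · have h5 : k + 1 - (k + e + 1 - s) ≠ 0 := by omega
      have h6 : b ≠ mv := by omega
      unfold stG
      rw [if_neg h5, if_neg h6]
      by_cases hLb : L = b
      · subst hLb
        split_ifs <;> simp only [ne_eq, Prod.mk.injEq] <;> omega
      · split_ifs <;> simp only [ne_eq, Prod.mk.injEq] <;> omega
  · intro L i s hL hi h1 h2 h3
    split_ifs with h4
    · have h5 : k + 1 - s ≠ 0 := by omega
      unfold ZOK at hz
      unfold stG
      rw [if_neg h5]
      rcases hm with ⟨rfl, rfl⟩ | ⟨rfl, rfl⟩ | ⟨rfl, rfl⟩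
      · by_cases hLb : L = a
        · subst hLb
          split_ifs <;> simp only [ne_eq, Prod.mk.injEq] <;> omega
        · split_ifs <;> simp only [ne_eq, Prod.mk.injEq] <;> omega
      · by_cases hLb : L = mu
        · subst hLb
          split_ifs <;> simp only [ne_eq, Prod.mk.injEq] <;> omega
        · split_ifs <;> simp only [ne_eq, Prod.mk.injEq] <;> omega
      · by_cases hLb : L = mv
        · subst hLb
          split_ifs <;> simp only [ne_eq, Prod.mk.injEq] <;> omega
        · split_ifs <;> simp only [ne_eq, Prod.mk.injEq] <;> omega
    · intro E
      have := hT.inj _ _ _ _ hL hb hi (by omega) E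
      omega
  · intro s s' h1 h2 h3 h4
    split_ifs with h5 h6 h6
    · intro E
      have := hS.inj _ _ _ _ ha ha (by omega) (by omega) E
      omega
    · have h7 : k + 1 - s ≠ 0 := by omega
      have h8 : k + 1 - (k + e + 1 - s') ≠ 0 := by omega
      have h9 : b ≠ mv := by omega
      unfold stG
      rw [if_neg h7, if_neg h8, if_neg h9]
      split_ifs <;> simp only [ne_eq, Prod.mk.injEq] <;> omega
    · omega
    · intro E
      have := hT.inj _ _ _ _ hb hb (by omega) (by omega) E
      omega
  · intro L i j hL h1 h2
    omega

set_option maxHeartbeats 2000000 in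
theorem edge_cross_two (k e z l a b : ℕ) (he : 1 ≤ e) (hek : e ≤ k) (hz : ZOK k e z)
    (hl : l < 3) (ha : a < 3) (hb : b < 3) (hla : l ≠ a) (hlb : l ≠ b) (hab : a ≠ b)
    (ε η : ℕ → Bool) (h : ε l ≠ η l) :
    EdgeOK 3 k (k + e) (stG k z ε a) (stG k z η b) l l
      (fun s => if s ≤ (k + e) / 2 then stG k z ε a b (k + 1 - s)
        else if k + e + 1 - s ≤ (k + e) / 2 then stG k z η b a (k + 1 - (k + e + 1 - s))
        else (0, 0)) := by
  have hz1 : 1 ≤ z := by unfold ZOK at hz; omega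
  have hzk : z ≤ k := by unfold ZOK at hz; omega
  have hS := stG_ok k z hz1 hzk ε a
  have hT := stG_ok k z hz1 hzk η b
  refine ⟨?_, ?_, ?_, ?_, ?_, ?_⟩
  · intro s h1 h2
    split_ifs
    · exact hS.val _ _ hb (by omega)
    · exact hT.val _ _ ha (by omega)
    · exact Or.inr rfl
  · intro i j hi hj hij
    have h3 : i ≠ 0 := by omega
    have h4 : j ≠ 0 := by omega
    unfold stG
    rw [if_neg h3, if_neg hla, if_neg h4, if_neg hlb]
    cases h5 : ε l <;> cases h6 : η l <;> simp_all <;> omega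
  · intro L i s hL hi h1 h2 h3
    split_ifs with h4 h4'
    · intro E
      have := hS.inj _ _ _ _ hL hb hi (by omega) E
      omega
    · have h5 : k + 1 - (k + e + 1 - s) ≠ 0 := by omega
      unfold ZOK at hz
      unfold stG
      rw [if_neg h5, if_neg hab]
      by_cases hLb : L = a
      · subst hLb
        split_ifs <;> simp only [ne_eq, Prod.mk.injEq] <;> omega
      · split_ifs <;> simp only [ne_eq, Prod.mk.injEq] <;> omega
    · unfold ZOK at hz
      unfold stG
      split_ifs <;> simp only [ne_eq, Prod.mk.injEq] <;> omega
  · intro L i s hL hi h1 h2 h3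
    split_ifs with h4 h4'
    · have h5 : k + 1 - s ≠ 0 := by omega
      unfold ZOK at hz
      unfold stG
      rw [if_neg h5, if_neg hab.symm]
      by_cases hLb : L = b
      · subst hLb
        split_ifs <;> simp only [ne_eq, Prod.mk.injEq] <;> omega
      · split_ifs <;> simp only [ne_eq, Prod.mk.injEq] <;> omega
    · intro E
      have := hT.inj _ _ _ _ hL ha hi (by omega) E
      omega
    · unfold ZOK at hz
      unfold stG
      split_ifs <;> simp only [ne_eq, Prod.mk.injEq] <;> omega
  · intro s s' h1 h2 h3 h4
    have hne1 : ∀ x, s ≤ (k + e) / 2 → x = s → stG k z ε a b (k + 1 - x) =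
        (b, if ε b = true then k + 1 - x else x) := by
      intro x hx hxs
      have h5 : k + 1 - x ≠ 0 := by omega
      unfold stG
      rw [if_neg h5, if_neg hab.symm]
      congr 2
      omega
    have hne2 : ∀ x, x ≤ k + e → k + e + 1 - x ≤ (k + e) / 2 →
        stG k z η b a (k + 1 - (k + e + 1 - x)) =
        (a, if η a = true then k + 1 - (k + e + 1 - x) else k + e + 1 - x) := by
      intro x hx hxs
      have h5 : k + 1 - (k + e + 1 - x) ≠ 0 := by omega
      unfold stG
      rw [if_neg h5, if_neg hab]
      congr 2
      omega
    by_cases h5 : s ≤ (k + e) / 2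
    · rw [if_pos h5]
      by_cases h6 : s' ≤ (k + e) / 2
      · rw [if_pos h6]
        intro E
        have := hS.inj _ _ _ _ hb hb (by omega) (by omega) E
        omega
      · rw [if_neg h6, hne1 s h5 rfl]
        by_cases h7 : k + e + 1 - s' ≤ (k + e) / 2
        · rw [if_pos h7, hne2 s' h3 h7]
          simp only [ne_eq, Prod.mk.injEq]
          omega
        · rw [if_neg h7]
          simp only [ne_eq, Prod.mk.injEq]
          split_ifs <;> omega
    · rw [if_neg h5, if_neg (by omega : ¬ s' ≤ (k + e) / 2)]
      by_cases h7 : k + e + 1 - s' ≤ (k + e) / 2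
      · rw [if_pos h7]
        by_cases h8 : k + e + 1 - s ≤ (k + e) / 2
        · rw [if_pos h8]
          intro E
          have := hT.inj _ _ _ _ ha ha (by omega) (by omega) E
          omega
        · rw [if_neg h8, hne2 s' h3 h7]
          simp only [ne_eq, Prod.mk.injEq]
          split_ifs <;> omega
      · omega
  · intro L i j hL h1 h2
    omega

set_option maxHeartbeats 2000000 in
theorem edge_M (k e z p q t : ℕ) (he : 1 ≤ e) (hek : e ≤ k) (hz : ZOK k e z)
    (hp : p < 3) (hq : q < 3) (ht : t < 3) (hpq : p ≠ q) (htp : t ≠ p) (htq : t ≠ q)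
    (ε η : ℕ → Bool) (h : ∀ l, ε l ≠ η l) :
    EdgeOK 3 k (k + e) (stG k z ε 3) (stG k z η q) p q
      (fun s => if s ≤ (e + 1) / 2 then stG k z η q q (s - 1)
        else if k + e - e / 2 + 1 ≤ s then stG k z ε 3 p (k + 1 + e - s)
        else stG k z ε 3 t ((e + 1) / 2 + k + 1 - s)) := by
  have hz1 : 1 ≤ z := by unfold ZOK at hz; omega
  have hzk : z ≤ k := by unfold ZOK at hz; omega
  have hS := stG_ok k z hz1 hzk ε 3
  have hT := stG_ok k z hz1 hzk η q
  have hSn : ∀ x i, x < 3 → i ≠ 0 → stG k z ε 3 x i = (x, if η x = true then k + 1 - i else i) := by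
    intro x i hx hi
    unfold stG
    rw [if_neg hi, if_neg (by omega)]
    have := h x
    cases h1 : ε x <;> cases h2 : η x <;> simp_all
  refine ⟨?_, ?_, ?_, ?_, ?_, ?_⟩
  · intro s h1 h2
    split_ifs
    · exact hT.val _ _ hq (by omega)
    · exact hS.val _ _ hp (by omega)
    · exact hS.val _ _ ht (by omega)
  · intro i j hi hj hij
    have h4 : j ≠ 0 := by omega
    rw [hSn p i hp (by omega)]
    unfold stG
    rw [if_neg h4, if_pos rfl]
    split_ifs <;> simp only [ne_eq, Prod.mk.injEq] <;> omega
  · intro L i s hL hi h1 h2 h3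
    split_ifs with h4 h4'
    · by_cases hi0 : i = 0
      · subst hi0
        unfold ZOK at hz
        unfold stG
        split_ifs <;> simp only [ne_eq, Prod.mk.injEq] <;> omega
      · rw [hSn L i hL hi0]
        unfold stG
        by_cases hLq : L = q
        · subst hLq
          split_ifs <;> simp only [ne_eq, Prod.mk.injEq] <;> omega
        · split_ifs <;> simp only [ne_eq, Prod.mk.injEq] <;> omega
    · intro E
      have := hS.inj _ _ _ _ hL hp hi (by omega) E
      omega
    · intro E
      have := hS.inj _ _ _ _ hL ht hi (by omega) E
      omega
  · intro L i s hL hi h1 h2 h3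
    split_ifs with h4 h4'
    · intro E
      have := hT.inj _ _ _ _ hL hq hi (by omega) E
      unfold ZOK at hz
      omega
    · rw [hSn p _ hp (by omega)]
      unfold stG
      by_cases hLq : L = p
      · subst hLq
        split_ifs <;> simp only [ne_eq, Prod.mk.injEq] <;> omega
      · split_ifs <;> simp only [ne_eq, Prod.mk.injEq] <;> omega
    · rw [hSn t _ ht (by omega)]
      unfold stG
      by_cases hLq : L = t
      · subst hLq
        split_ifs <;> simp only [ne_eq, Prod.mk.injEq] <;> omega
      · split_ifs <;> simp only [ne_eq, Prod.mk.injEq] <;> omega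
  · intro s s' h1 h2 h3 h4
    have hmix : ∀ x y j, x ≠ q → x < 3 → j ≠ 0 → j ≤ k →
        stG k z η q q y ≠ stG k z ε 3 x j := by
      intro x y j hx hx3 hj hjk
      rw [hSn x j hx3 hj]
      unfold stG
      split_ifs <;> simp only [ne_eq, Prod.mk.injEq] <;> omega
    by_cases h5 : s ≤ (e + 1) / 2
    · rw [if_pos h5]
      by_cases h6 : s' ≤ (e + 1) / 2
      · rw [if_pos h6]
        intro E
        have := hT.inj _ _ _ _ hq hq (by omega) (by omega) E
        omega
      · rw [if_neg h6]
        split_ifs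
        · exact hmix _ _ _ hpq hp (by omega) (by omega)
        · exact hmix _ _ _ htq ht (by omega) (by omega)
    · rw [if_neg h5, if_neg (by omega : ¬ s' ≤ (e + 1) / 2)]
      split_ifs
      · intro E
        have := hS.inj _ _ _ _ hp hp (by omega) (by omega) E
        omega
      · omega
      · intro E
        have := hS.inj _ _ _ _ ht hp (by omega) (by omega) E
        omega
      · intro E
        have := hS.inj _ _ _ _ ht ht (by omega) (by omega) E
        omega
  · intro L i j hL h1 h2
    omega

end CaseThreeLong

end FracPow

namespace FracPow

theorem case_three_long {V : Type*} [Fintype V] (G : SimpleGraph V) [DecidableRel G.Adj]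
    (hΔ : G.maxDegree = 3) (idx : V → ℕ) (hidx : Function.Injective idx)
    (k e : ℕ) (he : 1 ≤ e) (hek : e ≤ k) :
    ∃ (lab : V → V → ℕ) (st : V → ℕ → ℕ → ℕ × ℕ),
      (∀ u v, G.Adj u v → lab u v < G.maxDegree) ∧
      (∀ u v w, G.Adj u v → G.Adj u w → lab u v = lab u w → v = w) ∧
      (∀ u, StOK G.maxDegree k (st u)) ∧
      (∀ u v, G.Adj u v →
        ∃ mid, EdgeOK G.maxDegree k (k + e) (st u) (st v) (lab u v) (lab v u) mid) := by
  classical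
  rw [hΔ]
  obtain ⟨side, d, ε, hd1, hd2, hM, hd3, hd4⟩ := exists_structure G
    (fun u => hΔ ▸ G.degree_le_maxDegree u)
  obtain ⟨z, hz⟩ : ∃ z, ZOK k e z := by
    by_cases h : 2 ≤ e ∨ k = 1
    · exact ⟨k, Or.inl ⟨rfl, h⟩⟩
    · exact ⟨k / 2, Or.inr ⟨rfl, by omega, by omega⟩⟩
  have hz1 : 1 ≤ z := by unfold ZOK at hz; omega
  have hzk : z ≤ k := by unfold ZOK at hz; omega
  have hmo : ∀ v, ∃ m : ℕ,
      (∀ u, G.Adj v u → side v = side u → idx u < idx v → m = d v u) ∧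
      (m = 3 ∨ ∃ u, G.Adj v u ∧ side v = side u ∧ idx u < idx v ∧ m = d v u) := by
    intro v
    by_cases h : ∃ u, G.Adj v u ∧ side v = side u ∧ idx u < idx v
    · obtain ⟨u, h1, h2, h3⟩ := h
      refine ⟨d v u, ?_, Or.inr ⟨u, h1, h2, h3, rfl⟩⟩
      intro w a1 a2 _
      rw [hM v u w h1 a1 h2 a2]
    · exact ⟨3, fun u a b c => absurd ⟨u, a, b, c⟩ h, Or.inl rfl⟩
  choose mo hmo1 hmo2 using hmo
  have hcross : ∀ v w, G.Adj v w → side v ≠ side w → mo v = 3 ∨ (mo v < 3 ∧ mo v ≠ d v w) := by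
    intro v w h hs
    rcases hmo2 v with h1 | ⟨u, h1, h2, _, h3⟩
    · exact Or.inl h1
    · right
      refine ⟨h3 ▸ hd1 v u h1, ?_⟩
      intro h4
      have := hd2 v u w h1 h (h3 ▸ h4)
      subst this
      exact hs h2
  have hMedge : ∀ u v, G.Adj u v → side u = side v → idx u < idx v →
      ∃ mid, EdgeOK 3 k (k + e) (stG k z (ε u) (mo u)) (stG k z (ε v) (mo v)) (d u v) (d v u)
        mid := by
    intro u v h hs hlt
    have h1 : mo v = d v u := hmo1 v u h.symm hs.symm hlt
    have h2 : mo u = 3 := by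
      rcases hmo2 u with h2 | ⟨w, a1, a2, a3, _⟩
      · exact h2
      · have := hM u v w h a1 hs a2
        subst this
        omega
    rw [h1, h2]
    obtain ⟨h3, h4⟩ := hd4 u v h hs
    have h5 := hd1 u v h
    have h6 := hd1 v u h.symm
    exact ⟨_, edge_M k e z (d u v) (d v u) (3 - d u v - d v u) he hek hz h5 h6 (by omega) h3
      (by omega) (by omega) _ _ h4⟩
  refine ⟨d, fun v => stG k z (ε v) (mo v), hd1, hd2, fun v => stG_ok k z hz1 hzk _ _, ?_⟩
  intro u v h
  by_cases hs : side u = side v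
  · rcases Nat.lt_trichotomy (idx u) (idx v) with hlt | heq | hlt
    · exact hMedge u v h hs hlt
    · exact absurd (hidx heq) h.ne
    · obtain ⟨mid, hmid⟩ := hMedge v u h.symm hs.symm hlt
      exact ⟨_, hmid.symm⟩
  · obtain ⟨h1, h2⟩ := hd3 u v h hs
    have h3 := hcross u v h hs
    have h4 := hcross v u h.symm (Ne.symm hs)
    have h5 := hd1 u v h
    rw [← h1] at h4 ⊢
    generalize d u v = l at *
    beta_reduce
    generalize mo u = a at *
    generalize mo v = b at *
    by_cases ha : a = 3
    · by_cases hb : b = 3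
      · exact ⟨_, edge_cross_one k e z l ((l + 1) % 3) ((l + 2) % 3) a b he hek hz h5 (by omega)
          (by omega) (by omega) (by omega) (by omega) (by omega) _ _ h2⟩
      · exact ⟨_, (edge_cross_one k e z l b (3 - l - b) b a he hek hz h5 (by omega)
          (by omega) (by omega) (by omega) (by omega) (by omega) _ _ h2.symm).symm⟩
    · by_cases hab : a ≠ b ∧ b ≠ 3
      · exact ⟨_, edge_cross_two k e z l a b he hek hz h5 (by omega)
          (by omega) (by omega) (by omega) (by omega) _ _ h2⟩
      · exact ⟨_, edge_cross_one k e z l a (3 - l - a) a b he hek hz h5 (by omega)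
          (by omega) (by omega) (by omega) (by omega) (by omega) _ _ h2⟩

end FracPow

theorem chromatic_eq_clique_of_even_power {V : Type*} [Fintype V] (G : SimpleGraph V)
    [DecidableRel G.Adj] (hconn : G.Connected) (hΔ : 3 ≤ G.maxDegree)
    (m n : ℕ) (hm : Even m) (h1m : 1 < m) (hmn : m < n) :
    (fracPower G m n).chromaticNumber = (fracPower G m n).cliqueNum := by
  obtain ⟨k, rfl⟩ := hm
  rw [← two_mul] at h1m hmn ⊢
  haveI : Nonempty V := hconn.nonempty
  have hnb : ∀ u, ∃ v, G.Adj u v := by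
    intro u
    obtain ⟨w, hw⟩ := G.exists_maximal_degree_vertex
    by_cases huw : u = w
    · subst huw
      have : 0 < G.degree u := by omega
      exact (G.degree_pos_iff_exists_adj u).1 this
    · obtain ⟨p⟩ := hconn.preconnected u w
      cases p with
      | nil => exact absurd rfl huw
      | cons h _ => exact ⟨_, h⟩
  let idx : V → ℕ := fun v => (Fintype.equivFin V v : ℕ)
  have hidx : Function.Injective idx := fun a b h =>
    (Fintype.equivFin V).injective (Fin.ext h)
  refine FracPow.main_of_states G k n (by omega) hmn (by omega) hnb idx hidx ?_
  intro r hr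
  by_cases h4 : 4 ≤ G.maxDegree
  · exact FracPow.case_four G h4 k r hr
  · have h3 : G.maxDegree = 3 := by omega
    by_cases hrk : r ≤ k
    · exact FracPow.case_three_short G h3 k r hrk
    · obtain ⟨e, rfl⟩ : ∃ e, r = k + e := ⟨r - k, by omega⟩
      exact FracPow.case_three_long G h3 idx hidx k e (by omega) (by omega)
end

section
/- If m is an even integer with m ≥ 2 and G is a connected finite simple graph with maximum degree Δ(G) ≥ 4, and n is an integer with m < n, then χ(G^{m/n}) = (m/2)·Δ(G) + 1. -/
open SimpleGraph

/-! ### Two-colouring along two involutions -/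

theorem fp_two_color {Y : Type*} (s t : Y → Y) (hs : ∀ x, s (s x) = x) (ht : ∀ x, t (t x) = x)
    (hs' : ∀ x, s x ≠ x) (ht' : ∀ x, t x ≠ x) :
    ∃ c : Y → Bool, (∀ x, c (s x) ≠ c x) ∧ (∀ x, c (t x) ≠ c x) := by
  classical
  let S : Equiv.Perm Y := ⟨s, s, hs, hs⟩
  let T : Equiv.Perm Y := ⟨t, t, ht, ht⟩
  let P : Equiv.Perm Y := T * S
  have hS : S⁻¹ = S := rfl
  have hT : T⁻¹ = T := rfl
  have hSS : S * S = 1 := by ext x; exact hs x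
  have hconj : S * P * S⁻¹ = P⁻¹ := by
    simp only [P, mul_inv_rev, hS, hT]
    rw [mul_assoc, mul_assoc, hSS, mul_one]
  have hz : ∀ (i : ℤ) (x : Y), S ((P ^ i) x) = (P ^ (-i)) (S x) := by
    intro i x
    have h : S * P ^ i * S⁻¹ = P ^ (-i) := by
      rw [← conj_zpow, hconj, inv_zpow, zpow_neg]
    rw [← h]; simp
  have key : ∀ x, ¬ P.SameCycle x (S x) := by
    rintro x ⟨j, hj⟩
    rcases Int.even_or_odd' j with ⟨i, rfl | rfl⟩
    · apply hs' ((P ^ i) x)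
      change S ((P ^ i) x) = _
      rw [hz, ← hj, ← Equiv.Perm.mul_apply, ← zpow_add]
      congr 2; ring
    · apply ht' (S ((P ^ i) x))
      change P ((P ^ i) x) = _
      rw [hz, ← hj, ← Equiv.Perm.mul_apply, ← Equiv.Perm.mul_apply, ← zpow_add, ← zpow_one_add]
      congr 2; ring
  have hsame : ∀ x y, P.SameCycle x y → P.SameCycle (S x) (S y) := by
    rintro x y ⟨i, rfl⟩
    exact ⟨-i, (hz i x).symm⟩
  let st : Setoid Y := Equiv.Perm.SameCycle.setoid P
  let q : Y → Quotient st := fun x => Quotient.mk st x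
  have hq : ∀ x y, q x = q y ↔ P.SameCycle x y := fun x y => Quotient.eq
  let _ : LinearOrder (Quotient st) := linearOrderOfSTO WellOrderingRel
  have hne : ∀ x, q (S x) ≠ q x := fun x h => key x ((hq _ _).1 h).symm
  have hSs : ∀ x, S (S x) = x := hs
  have h1 : ∀ x, decide (q (S x) < q (S (S x))) ≠ decide (q x < q (S x)) := by
    intro x
    rw [hSs]
    rcases lt_or_gt_of_ne (hne x) with h | h
    · simp [h, h.le]
    · simp [h, h.le]
  refine ⟨fun x => decide (q x < q (S x)), h1, fun x => ?_⟩
  have e : P.SameCycle (S x) (t x) := ⟨1, by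
    change T (S (S x)) = t x
    rw [hSs]; rfl⟩
  have e1 : q (t x) = q (S x) := ((hq _ _).2 e).symm
  have e2 : q (S (t x)) = q (S (S x)) := ((hq _ _).2 (hsame _ _ e)).symm
  change decide (q (t x) < q (S (t x))) ≠ _
  rw [e1, e2]
  exact h1 x

theorem two_color {X : Type*} (s t : X → X) (hs : ∀ x, s (s x) = x) (ht : ∀ x, t (t x) = x) :
    ∃ c : X → Bool, (∀ x, s x ≠ x → c (s x) ≠ c x) ∧ (∀ x, t x ≠ x → c (t x) ≠ c x) := by
  classical
  have aux : ∀ f : X → X, (∀ x, f (f x) = x) → ∃ g : X × Bool → X × Bool,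
      (∀ y, g (g y) = y) ∧ (∀ y, g y ≠ y) ∧ ∀ x, f x ≠ x → g (x, true) = (f x, true) := by
    intro f hf
    refine ⟨fun y => if f y.1 = y.1 then (y.1, !y.2) else (f y.1, y.2), ?_, ?_, ?_⟩
    · rintro ⟨x, b⟩
      by_cases h : f x = x
      · simp [h]
      · simp [h, hf, Ne.symm h]
    · rintro ⟨x, b⟩
      by_cases h : f x = x
      · simp [h]
      · simp [h]
    · intro x h
      simp [h]
  obtain ⟨s', a1, a2, a3⟩ := aux s hs
  obtain ⟨t', b1, b2, b3⟩ := aux t ht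
  obtain ⟨c, c1, c2⟩ := fp_two_color s' t' a1 b1 a2 b2
  refine ⟨fun x => c (x, true), fun x hx => ?_, fun x hx => ?_⟩
  · have := c1 (x, true); rwa [a3 x hx] at this
  · have := c2 (x, true); rwa [b3 x hx] at this

theorem split_color {X V : Type*} (s : X → X) (hs : ∀ x, s (s x) = x) (hs' : ∀ x, s x ≠ x)
    (vtx : X → V) (idx : X → ℕ) (A : X → Prop)
    (hinj : ∀ x y, A x → A y → vtx x = vtx y → idx x = idx y → x = y) :
    ∃ c : X → Bool, (∀ x, c (s x) ≠ c x) ∧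
      ∀ x y, A x → A y → x ≠ y → vtx x = vtx y → idx x / 2 = idx y / 2 → c x ≠ c y := by
  classical
  let R : X → X → Prop := fun x y => A x ∧ A y ∧ x ≠ y ∧ vtx x = vtx y ∧ idx x / 2 = idx y / 2
  have Rs : ∀ x y, R x y → R y x := fun x y ⟨a, b, c, d, e⟩ => ⟨b, a, c.symm, d.symm, e.symm⟩
  have Ru : ∀ x y z, R x y → R x z → y = z := by
    rintro x y z ⟨a, b, c, d, e⟩ ⟨a', b', c', d', e'⟩
    apply hinj y z b b' (d.symm.trans d')
    have h1 : idx x ≠ idx y := fun h => c (hinj x y a b d h)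
    have h2 : idx x ≠ idx z := fun h => c' (hinj x z a b' d' h)
    omega
  let t : X → X := fun x => if h : ∃ y, R x y then h.choose else x
  have tR : ∀ x y, R x y → t x = y := by
    intro x y h
    have h' : ∃ y, R x y := ⟨y, h⟩
    simp only [t, dif_pos h']
    exact Ru x _ _ h'.choose_spec h
  have ht : ∀ x, t (t x) = x := by
    intro x
    by_cases h : ∃ y, R x y
    · obtain ⟨y, h⟩ := h
      rw [tR x y h, tR y x (Rs _ _ h)]
    · have : t x = x := by simp only [t, dif_neg h]
      rw [this, this]
  obtain ⟨c, c1, c2⟩ := two_color s t hs ht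
  refine ⟨c, fun x => c1 x (hs' x), fun x y a b h d e => ?_⟩
  have hR := tR x y ⟨a, b, h, d, e⟩
  have := c2 x (by rw [hR]; exact h.symm)
  rw [hR] at this
  exact this.symm

/-- Konig-type labelling of half-edges. -/
theorem half_labels {X V : Type*} (s : X → X) (hs : ∀ x, s (s x) = x) (hs' : ∀ x, s x ≠ x)
    (vtx : X → V) (D : ℕ) (hD : 2 ≤ D) (idx : X → ℕ) (hlt : ∀ x, idx x < D)
    (hinj : ∀ x y, vtx x = vtx y → idx x = idx y → x = y) :
    ∃ L : X → ℕ, (∀ x, L x < D) ∧ (∀ x, L (s x) ≠ L x) ∧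
      ∀ x y, x ≠ y → vtx x = vtx y → L x ≠ L y := by
  classical
  obtain ⟨c0, c1, c2⟩ := split_color s hs hs' vtx idx (fun _ => True)
    (fun x y _ _ => hinj x y)
  have bt : ∀ b : Bool, b.toNat ≤ 1 := by decide
  have binj : ∀ b b' : Bool, b ≠ b' → b.toNat ≠ b'.toNat := by decide
  rcases Nat.even_or_odd' D with ⟨e, rfl | rfl⟩
  · refine ⟨fun x => 2 * (idx x / 2) + (c0 x).toNat, fun x => ?_, fun x => ?_, fun x y h hv => ?_⟩
    · have := bt (c0 x); have := hlt x; dsimp only; omega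
    · have := binj _ _ (c1 x); have := bt (c0 x); have := bt (c0 (s x)); dsimp only; omega
    · dsimp only
      have := bt (c0 x); have := bt (c0 y)
      by_cases h2 : idx x / 2 = idx y / 2
      · have := binj _ _ (c2 x y trivial trivial h hv h2); omega
      · omega
  · let ch : X → Prop := fun x => idx x < 2 ∧ c0 x = true
    have miss : ∀ v : V, ∃ m, m < 2 ∧ ∀ x, vtx x = v → ¬ ch x → idx x ≠ m := by
      intro v
      by_contra hcon
      push Not at hcon
      obtain ⟨x, hx, hcx, hix⟩ := hcon 0 (by norm_num)
      obtain ⟨y, hy, hcy, hiy⟩ := hcon 1 (by norm_num)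
      have hxy : x ≠ y := by rintro rfl; omega
      have := c2 x y trivial trivial hxy (hx.trans hy.symm) (by omega)
      have f1 : c0 x = false := by
        by_contra h; exact hcx ⟨by omega, by simpa using h⟩
      have f2 : c0 y = false := by
        by_contra h; exact hcy ⟨by omega, by simpa using h⟩
      exact this (f1.trans f2.symm)
    choose ms hms hms' using miss
    let idx1 : X → ℕ := fun x => if idx x = 2 * e then ms (vtx x) else idx x
    have lt1 : ∀ x, idx1 x < 2 * e := by
      intro x
      have := hlt x; have := hms (vtx x)
      simp only [idx1]; split_ifs <;> omega
    obtain ⟨c, d1, d2⟩ := split_color s hs hs' vtx idx1 (fun x => ¬ ch x) (by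
      intro x y hx hy hv hi
      apply hinj x y hv
      have h1 := hms' _ x rfl hx
      have h2 := hms' _ y rfl hy
      simp only [idx1] at hi
      rw [hv] at hi h1
      split_ifs at hi <;> omega)
    have chu : ∀ x y, ch x → ch y → vtx x = vtx y → x = y := by
      intro x y hx hy hv
      by_contra h
      exact c2 x y trivial trivial h hv (by have := hx.1; have := hy.1; omega) (hx.2.trans hy.2.symm)
    refine ⟨fun x => if ch x then 2 * e else 2 * (idx1 x / 2) + (c x).toNat, fun x => ?_,
      fun x => ?_, fun x y h hv => ?_⟩
    · have := bt (c x); have := lt1 x; dsimp only; split_ifs <;> omega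
    · have := binj _ _ (d1 x); have := bt (c x); have := bt (c (s x))
      have := lt1 x; have := lt1 (s x)
      dsimp only
      split_ifs with h1 h2
      · exact absurd (h1.2.trans h2.2.symm) (c1 x)
      all_goals omega
    · have := bt (c x); have := bt (c y)
      have := lt1 x; have := lt1 y
      dsimp only
      split_ifs with h1 h2 h2
      · exact absurd (chu x y h1 h2 hv) h
      · omega
      · omega
      · by_cases h3 : idx1 x / 2 = idx1 y / 2
        · have := binj _ _ (d2 x y h1 h2 h hv h3); omega
        · omega

theorem graph_labels {V : Type*} [Fintype V] (G : SimpleGraph V) [DecidableRel G.Adj]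
    (hD : 2 ≤ G.maxDegree) :
    ∃ L : V → V → ℕ, (∀ u v, G.Adj u v → L u v < G.maxDegree) ∧
      (∀ u v, G.Adj u v → L u v ≠ L v u) ∧
      ∀ u v w, G.Adj u v → G.Adj u w → v ≠ w → L u v ≠ L u w := by
  classical
  have hidx : ∀ u : V, ∃ f : G.neighborSet u → Fin G.maxDegree, Function.Injective f := by
    intro u
    have : Fintype.card (G.neighborSet u) ≤ Fintype.card (Fin G.maxDegree) := by
      rw [G.card_neighborSet_eq_degree, Fintype.card_fin]
      exact G.degree_le_maxDegree u
    exact ⟨_, (Function.Embedding.nonempty_of_card_le this).some.injective⟩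
  choose f hf using hidx
  obtain ⟨L, h1, h2, h3⟩ := half_labels (X := G.Dart) SimpleGraph.Dart.symm
    (fun d => d.symm_symm) (fun d => d.symm_ne) (fun d => d.fst) G.maxDegree hD
    (fun d => f d.fst ⟨d.snd, d.adj⟩) (fun d => (f _ _).2) (by
      rintro ⟨⟨a, b⟩, h⟩ ⟨⟨a', b'⟩, h'⟩ hv hi
      dsimp only at hv
      subst hv
      have := hf a (Fin.ext hi)
      have hb : b = b' := congrArg Subtype.val this
      subst hb
      rfl)
  refine ⟨fun u v => if h : G.Adj u v then L ⟨(u, v), h⟩ else 0, ?_, ?_, ?_⟩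
  · intro u v h; simp only [dif_pos h]; exact h1 _
  · intro u v h; simp only [dif_pos h, dif_pos h.symm]; exact (h2 ⟨(u, v), h⟩).symm
  · intro u v w h h' hn
    simp only [dif_pos h, dif_pos h']
    apply h3
    · intro he
      apply hn
      have := congrArg (fun d : G.Dart => d.snd) he
      exact this
    · rfl

/-! ### Words along the edges -/

structure IsWord (k D a b n : ℕ) (w : ℕ → ℕ × ℕ) : Prop where
  lab : ∀ i ≤ n, (w i).1 < D
  ind : ∀ i ≤ n, (w i).2 ≤ k
  zero : ∀ i ≤ n, (w i).2 = 0 → (w i).1 = 0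
  start : w 0 = (0, 0)
  fin : w n = (0, 0)
  left : ∀ i, 1 ≤ i → i ≤ k → w i = (a, i)
  right : ∀ i, 1 ≤ i → i ≤ k → w (n - i) = (b, i)
  dist : ∀ i j, i < j → j ≤ n → j ≤ i + 2 * k → w i ≠ w j
  mid : ∀ i j, k < i → 1 ≤ j → i + j ≤ 2 * k → (w i).2 ≠ j
  mid' : ∀ i j, k < i → 1 ≤ j → i + j ≤ 2 * k → (w (n - i)).2 ≠ j

theorem IsWord.rev {k D a b n : ℕ} {w : ℕ → ℕ × ℕ} (h : IsWord k D a b n w) (hn : 2 * k < n) :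
    IsWord k D b a n (fun i => w (n - i)) where
  lab i hi := h.lab _ (by omega)
  ind i hi := h.ind _ (by omega)
  zero i hi := h.zero _ (by omega)
  start := by simpa using h.fin
  fin := by simpa using h.start
  left := h.right
  right i h1 h2 := by
    have := h.left i h1 h2
    have e : n - (n - i) = i := by omega
    simpa [e] using this
  dist i j h1 h2 h3 := (h.dist (n - j) (n - i) (by omega) (by omega) (by omega)).symm
  mid := h.mid'
  mid' i j h1 h2 h3 := by
    have := h.mid i j h1 h2 h3
    have e : n - (n - i) = i := by omega
    simpa [e] using this

theorem word_base (k D a b n : ℕ) (hk : 1 ≤ k) (hD : 4 ≤ D) (ha : a < D) (hb : b < D)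
    (hab : a ≠ b) (hn : 2 * k < n) (hn2 : n ≤ 4 * k + 1) : ∃ w, IsWord k D a b n w := by
  obtain ⟨c, d, hc, hd, h1, h2, h3, h4, h5⟩ : ∃ c d, c < D ∧ d < D ∧ c ≠ a ∧ c ≠ b ∧ d ≠ a ∧
      d ≠ b ∧ c ≠ d := by
    have hc : ∃ c < 3, c ≠ a ∧ c ≠ b := by
      by_contra hcon
      push Not at hcon
      have := hcon 0; have := hcon 1; have := hcon 2
      omega
    obtain ⟨c, hc, h1, h2⟩ := hc
    have hd : ∃ d < 4, d ≠ a ∧ d ≠ b ∧ d ≠ c := by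
      by_contra hcon
      push Not at hcon
      have := hcon 0; have := hcon 1; have := hcon 2; have := hcon 3
      omega
    obtain ⟨d, hd, h3, h4, h5⟩ := hd
    exact ⟨c, d, by omega, by omega, h1, h2, h3, h4, h5.symm⟩
  let w : ℕ → ℕ × ℕ := fun i => if i = 0 ∨ n ≤ i then (0, 0) else if i ≤ k then (a, i) else
    if n ≤ i + k then (b, n - i) else if 2 * i ≤ n then (c, 2 * k + 1 - i) else
    (d, 2 * k + 1 - (n - i))
  refine ⟨w, ?_, ?_, ?_, ?_, ?_, ?_, ?_, ?_, ?_, ?_⟩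
  · intro i hi; simp only [w]; split_ifs <;> dsimp only <;> omega
  · intro i hi; simp only [w]; split_ifs <;> dsimp only <;> omega
  · intro i hi; simp only [w]; split_ifs <;> dsimp only <;> omega
  · simp [w]
  · simp [w]
  · intro i h1 h2; simp only [w]; rw [if_neg (by omega), if_pos h2]
  · intro i h1 h2; simp only [w]
    rw [if_neg (by omega), if_neg (by omega), if_pos (by omega)]
    congr 1; omega
  · intro i j h1 h2 h3; simp only [w]
    split_ifs <;> simp only [ne_eq, Prod.mk.injEq] <;> omega
  · intro i j h1 h2 h3; simp only [w]; split_ifs <;> dsimp only <;> omega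
  · intro i j h1 h2 h3; simp only [w]; split_ifs <;> dsimp only <;> omega

theorem word_step (k D a b n : ℕ) (hn : 2 * k < n)
    (w : ℕ → ℕ × ℕ) (h : IsWord k D a b n w) :
    ∃ w, IsWord k D a b (n + (2 * k + 1)) w := by
  have e1 : ∀ i, i ≤ 2 * k → (fun i => if i ≤ 2 * k then w i else w (i - (2 * k + 1))) i = w i :=
    fun i hi => if_pos hi
  have e2 : ∀ i, 2 * k < i → (fun i => if i ≤ 2 * k then w i else w (i - (2 * k + 1))) i =
    w (i - (2 * k + 1)) := fun i hi => if_neg (by omega)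
  refine ⟨fun i => if i ≤ 2 * k then w i else w (i - (2 * k + 1)), ?_⟩
  generalize (fun i => if i ≤ 2 * k then w i else w (i - (2 * k + 1))) = w' at e1 e2
  have e3 : ∀ i, i ≤ n → w' (n + (2 * k + 1) - i) = w (n - i) := fun i hi => by
    rw [e2 _ (by omega)]; congr 1; omega
  refine ⟨?_, ?_, ?_, ?_, ?_, ?_, ?_, ?_, ?_, ?_⟩
  · intro i hi
    by_cases hk : i ≤ 2 * k
    · rw [e1 i hk]; exact h.lab i (by omega)
    · rw [e2 i (by omega)]; exact h.lab _ (by omega)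
  · intro i hi
    by_cases hk : i ≤ 2 * k
    · rw [e1 i hk]; exact h.ind i (by omega)
    · rw [e2 i (by omega)]; exact h.ind _ (by omega)
  · intro i hi
    by_cases hk : i ≤ 2 * k
    · rw [e1 i hk]; exact h.zero i (by omega)
    · rw [e2 i (by omega)]; exact h.zero _ (by omega)
  · rw [e1 0 (by omega)]; exact h.start
  · have := e3 0 (by omega)
    simp only [Nat.sub_zero] at this
    rw [this]; exact h.fin
  · intro i h1 h2
    rw [e1 i (by omega)]; exact h.left i h1 h2
  · intro i h1 h2
    rw [e3 i (by omega)]; exact h.right i h1 h2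
  · intro i j h1 h2 h3
    by_cases hi : i ≤ 2 * k
    · by_cases hj : j ≤ 2 * k
      · rw [e1 i hi, e1 j hj]; exact h.dist i j h1 (by omega) h3
      · rw [e1 i hi, e2 j (by omega)]
        exact (h.dist _ i (by omega) (by omega) (by omega)).symm
    · rw [e2 i (by omega), e2 j (by omega)]
      exact h.dist _ _ (by omega) (by omega) (by omega)
  · intro i j h1 h2 h3
    rw [e1 i (by omega)]; exact h.mid i j h1 h2 h3
  · intro i j h1 h2 h3
    rw [e3 i (by omega)]; exact h.mid' i j h1 h2 h3

theorem word_exists (k D a b : ℕ) (hk : 1 ≤ k) (hD : 4 ≤ D) (ha : a < D) (hb : b < D)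
    (hab : a ≠ b) (n : ℕ) (hn : 2 * k < n) : ∃ w, IsWord k D a b n w := by
  induction n using Nat.strong_induction_on with
  | _ n ih =>
    by_cases h : n ≤ 4 * k + 1
    · exact word_base k D a b n hk hD ha hb hab hn h
    · obtain ⟨w, hw⟩ := ih (n - (2 * k + 1)) (by omega) (by omega)
      have := word_step k D a b _ (by omega) w hw
      rwa [Nat.sub_add_cancel (by omega)] at this

/-! ### Distance estimates in the subdivision -/

open Classical in
/-- Truncated distance from a represented point to the branch vertex `p`. -/
noncomputable def preB {V : Type*} (n M : ℕ) (p : V) (x : V × V × ℕ) : ℕ :=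
  min (if x.1 = p then x.2.2 else M) (if x.2.1 = p then n - x.2.2 else M)

open Classical in
/-- Truncated distance from a represented point to `(p, q, s)` inside the edge `pq`. -/
noncomputable def preE {V : Type*} (n M : ℕ) (p q : V) (s : ℕ) (x : V × V × ℕ) : ℕ :=
  min (if x.1 = p ∧ x.2.1 = q then (x.2.2 - s) + (s - x.2.2) else M)
    (if x.1 = q ∧ x.2.1 = p then (n - x.2.2 - s) + (s - (n - x.2.2)) else M)

/-- Truncated distance from a represented point to `(p, q, s)`. -/
noncomputable def prePhi {V : Type*} (n M : ℕ) (p q : V) (s : ℕ) (x : V × V × ℕ) : ℕ :=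
  min M (min (preE n M p q s x) (min (preB n M p x + s) (preB n M q x + (n - s))))

theorem preB_flip {V : Type*} (n M : ℕ) (p u v : V) (i : ℕ) (hi : i ≤ n) :
    preB n M p (v, u, n - i) = preB n M p (u, v, i) := by
  simp only [preB]
  rw [min_comm, Nat.sub_sub_self hi]

theorem preE_flip {V : Type*} (n M : ℕ) (p q u v : V) (s i : ℕ) (hi : i ≤ n) :
    preE n M p q s (v, u, n - i) = preE n M p q s (u, v, i) := by
  simp only [preE]
  rw [min_comm, Nat.sub_sub_self hi]
  congr 2 <;> simp only [and_comm]

theorem prePhi_rel {V : Type*} (G : SimpleGraph V) (n M : ℕ) (hM : M ≤ n) {p q : V}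
    (hpq : p ≠ q) (s : ℕ) (hs : s ≤ n) (x y : SubdivPre G n) (h : SubdivRel G n x y) :
    prePhi n M p q s x.1 = prePhi n M p q s y.1 := by
  cases h with
  | flip u v i h hi =>
    simp only [prePhi]
    rw [preB_flip n M p u v i hi, preB_flip n M q u v i hi, preE_flip n M p q u v s i hi]
  | collapse u v h =>
    have hne := h.ne
    simp only [prePhi, preB, preE]
    by_cases h1 : u = p
    · subst h1
      by_cases h4 : v = q
      · subst h4
        simp [hne, hne.symm]; omega
      · simp [hne.symm, hpq, h4]
    · by_cases h2 : u = q
      · subst h2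
        by_cases h4 : v = p
        · subst h4
          simp [hne, hne.symm]; omega
        · simp [h4, h1, hne.symm]
      · simp only [h1, h2, if_false, false_and]
        split_ifs <;> omega

/-- Truncated distance from a point of the subdivision to `(p, q, s)`. -/
noncomputable def phi {V : Type*} (G : SimpleGraph V) (n M : ℕ) (hM : M ≤ n) {p q : V}
    (hpq : p ≠ q) (s : ℕ) (hs : s ≤ n) : SubdivVert G n → ℕ :=
  Quot.lift (fun x => prePhi n M p q s x.1) (prePhi_rel G n M hM hpq s hs)

theorem prePhi_step {V : Type*} (n M : ℕ) (p q u v : V) (s i : ℕ) (hi : i < n) :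
    prePhi n M p q s (u, v, i) ≤ prePhi n M p q s (u, v, i + 1) + 1 ∧
    prePhi n M p q s (u, v, i + 1) ≤ prePhi n M p q s (u, v, i) + 1 := by
  have hB : ∀ r, preB n M r (u, v, i) ≤ preB n M r (u, v, i + 1) + 1 ∧
    preB n M r (u, v, i + 1) ≤ preB n M r (u, v, i) + 1 := by
    intro r
    simp only [preB]
    split_ifs <;> omega
  have hE : preE n M p q s (u, v, i) ≤ preE n M p q s (u, v, i + 1) + 1 ∧
    preE n M p q s (u, v, i + 1) ≤ preE n M p q s (u, v, i) + 1 := by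
    simp only [preE]
    split_ifs <;> omega
  have h1 := hB p
  have h2 := hB q
  simp only [prePhi]
  omega

theorem phi_walk {V : Type*} (G : SimpleGraph V) (n M : ℕ) (hM : M ≤ n) {p q : V}
    (hpq : p ≠ q) (s : ℕ) (hs : s ≤ n) {x y : SubdivVert G n}
    (w : (subdivision G n).Walk x y) :
    phi G n M hM hpq s hs y ≤ phi G n M hM hpq s hs x + w.length := by
  induction w with
  | nil => simp
  | cons h w ih =>
    rw [SimpleGraph.Walk.length_cons]
    rw [subdivision, SimpleGraph.fromRel_adj] at h
    obtain ⟨_, ⟨u, v, h, i, hi, rfl, rfl⟩ | ⟨u, v, h, i, hi, rfl, rfl⟩⟩ := h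
    all_goals
      have := prePhi_step n M p q u v s i hi
      simp only [phi, mkVert] at ih ⊢
      omega

theorem phi_self {V : Type*} (G : SimpleGraph V) (n M : ℕ) (hM : M ≤ n) {p q : V}
    (h : G.Adj p q) (s : ℕ) (hs : s ≤ n) :
    phi G n M hM h.ne s hs (mkVert G n h s hs) = 0 := by
  simp [phi, mkVert, prePhi, preE]

theorem near_cases {V : Type*} (n k : ℕ) {p q u v : V} (hpq : p ≠ q)
    (s i : ℕ) (h : prePhi n (2 * k + 1) p q s (u, v, i) ≤ 2 * k) :
    (u = p ∧ v = q ∧ i ≤ s + 2 * k ∧ s ≤ i + 2 * k) ∨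
    (u = q ∧ v = p ∧ n - i ≤ s + 2 * k ∧ s ≤ (n - i) + 2 * k) ∨
    (u = p ∧ i + s ≤ 2 * k) ∨ (v = p ∧ (n - i) + s ≤ 2 * k) ∨
    (u = q ∧ i + (n - s) ≤ 2 * k) ∨ (v = q ∧ (n - i) + (n - s) ≤ 2 * k) := by
  have hB : ∀ r d, preB n (2 * k + 1) r (u, v, i) + d ≤ 2 * k →
      (u = r ∧ i + d ≤ 2 * k) ∨ (v = r ∧ (n - i) + d ≤ 2 * k) := by
    intro r d hr
    simp only [preB] at hr
    by_cases h1 : u = r <;> by_cases h2 : v = r <;> simp only [h1, h2, if_true, if_false, true_and, false_and, or_false,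
      false_or] at hr ⊢ <;> omega
  simp only [prePhi] at h
  have hcases : preE n (2 * k + 1) p q s (u, v, i) ≤ 2 * k ∨
    preB n (2 * k + 1) p (u, v, i) + s ≤ 2 * k ∨
    preB n (2 * k + 1) q (u, v, i) + (n - s) ≤ 2 * k := by omega
  rcases hcases with h | h | h
  · simp only [preE] at h
    by_cases h1 : u = p ∧ v = q
    · left
      have h2 : ¬ (u = q ∧ v = p) := fun h2 => hpq (h1.1.symm.trans h2.1)
      rw [if_pos h1, if_neg h2] at h
      exact ⟨h1.1, h1.2, by omega, by omega⟩
    · rw [if_neg h1] at h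
      by_cases h2 : u = q ∧ v = p
      · rw [if_pos h2] at h
        right; left
        exact ⟨h2.1, h2.2, by omega, by omega⟩
      · rw [if_neg h2] at h; omega
  · rcases hB _ _ h with h | h
    · exact Or.inr (Or.inr (Or.inl h))
    · exact Or.inr (Or.inr (Or.inr (Or.inl h)))
  · rcases hB _ _ h with h | h
    · exact Or.inr (Or.inr (Or.inr (Or.inr (Or.inl h))))
    · exact Or.inr (Or.inr (Or.inr (Or.inr (Or.inr h))))

theorem mkVert_flip {V : Type*} (G : SimpleGraph V) (n : ℕ) {u v : V} (h : G.Adj u v) (i : ℕ)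
    (hi : i ≤ n) : mkVert G n h i hi = mkVert G n h.symm (n - i) (Nat.sub_le n i) :=
  Quot.sound (SubdivRel.flip u v i h hi)

theorem mkVert_zero {V : Type*} (G : SimpleGraph V) (n : ℕ) {u v : V} (h : G.Adj u v) :
    mkVert G n h 0 (Nat.zero_le n) = branchVertex G n u :=
  Quot.sound (SubdivRel.collapse u v h)

/-- Points joined by a short walk either lie on a common edge, or near a common branch vertex. -/
theorem near_of_walk {V : Type*} (G : SimpleGraph V) (n k : ℕ) (hn : 2 * k < n) {p q u v : V}
    (h : G.Adj p q) (h' : G.Adj u v) (s i : ℕ) (hs : s ≤ n) (hi : i ≤ n)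
    (w : (subdivision G n).Walk (mkVert G n h s hs) (mkVert G n h' i hi))
    (hw : w.length ≤ 2 * k) :
    (∃ j, ∃ hj : j ≤ n, mkVert G n h' i hi = mkVert G n h j hj ∧ j ≤ s + 2 * k ∧ s ≤ j + 2 * k) ∨
    (∃ (a b c : V) (hb : G.Adj a b) (hc : G.Adj a c) (i' s' : ℕ) (hi' : i' ≤ n) (hs' : s' ≤ n),
      mkVert G n h s hs = mkVert G n hb s' hs' ∧ mkVert G n h' i hi = mkVert G n hc i' hi' ∧
      i' + s' ≤ 2 * k) := by
  have h0 := phi_walk G n (2 * k + 1) hn h.ne s hs w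
  rw [phi_self] at h0
  rcases near_cases n k h.ne s i (by simpa [phi, mkVert] using h0.trans (by omega)) with
    H | H | H | H | H | H
  · obtain ⟨rfl, rfl, h1, h2⟩ := H
    exact Or.inl ⟨i, hi, rfl, h1, h2⟩
  · obtain ⟨rfl, rfl, h1, h2⟩ := H
    exact Or.inl ⟨n - i, Nat.sub_le _ _, mkVert_flip G n h' i hi, h1, h2⟩
  · obtain ⟨rfl, h1⟩ := H
    exact Or.inr ⟨u, q, v, h, h', i, s, hi, hs, rfl, rfl, h1⟩
  · obtain ⟨rfl, h1⟩ := H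
    exact Or.inr ⟨v, q, u, h, h'.symm, n - i, s, Nat.sub_le _ _, hs, rfl,
      mkVert_flip G n h' i hi, h1⟩
  · obtain ⟨rfl, h1⟩ := H
    exact Or.inr ⟨u, p, v, h.symm, h', i, n - s, hi, Nat.sub_le _ _,
      mkVert_flip G n h s hs, rfl, h1⟩
  · obtain ⟨rfl, h1⟩ := H
    exact Or.inr ⟨v, p, u, h.symm, h'.symm, n - i, n - s, Nat.sub_le _ _, Nat.sub_le _ _,
      mkVert_flip G n h s hs, mkVert_flip G n h' i hi, h1⟩

theorem walk_from_branch {V : Type*} (G : SimpleGraph V) (n : ℕ) {u v : V}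
    (h : G.Adj u v) (i : ℕ) (hi : i ≤ n) :
    ∃ w : (subdivision G n).Walk (branchVertex G n u) (mkVert G n h i hi), w.length ≤ i := by
  induction i with
  | zero => rw [mkVert_zero]; exact ⟨SimpleGraph.Walk.nil, le_rfl⟩
  | succ i ih =>
    obtain ⟨w, hw⟩ := ih (by omega)
    by_cases he : mkVert G n h i (by omega) = mkVert G n h (i + 1) hi
    · rw [← he]; exact ⟨w, by omega⟩
    · have hadj : (subdivision G n).Adj (mkVert G n h i (by omega)) (mkVert G n h (i + 1) hi) := by
        rw [subdivision, SimpleGraph.fromRel_adj]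
        exact ⟨he, Or.inl ⟨u, v, h, i, hi, rfl, rfl⟩⟩
      refine ⟨w.concat hadj, ?_⟩
      rw [SimpleGraph.Walk.length_concat]; omega

theorem lower_bound {V : Type*} [Fintype V] (G : SimpleGraph V) [DecidableRel G.Adj]
    (k n : ℕ) (hn : 2 * k < n) (u : V) :
    ((k * G.degree u + 1 : ℕ) : ℕ∞) ≤ (fracPower G (2 * k) n).chromaticNumber := by
  classical
  let T := Option (G.neighborSet u × Fin k)
  let f : T → SubdivVert G n := fun x => match x with
    | none => branchVertex G n u
    | some (v, i) => mkVert G n v.2 (i.1 + 1) (by omega)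
  have hw : ∀ x : T, ∃ w : (subdivision G n).Walk (branchVertex G n u) (f x), w.length ≤ k := by
    rintro (_ | ⟨v, i⟩)
    · exact ⟨SimpleGraph.Walk.nil, Nat.zero_le _⟩
    · obtain ⟨w, hw⟩ := walk_from_branch G n v.2 (i.1 + 1) (by omega)
      exact ⟨w, by omega⟩
  have hinj1 : ∀ (v : G.neighborSet u) (i : Fin k) (y : T), f (some (v, i)) = f y →
      some (v, i) = y := by
    intro v i y hy
    have h0 := phi_self G n (2 * k + 1) hn v.2 (i.1 + 1) (by omega)
    change phi G n (2 * k + 1) hn _ _ _ (f (some (v, i))) = 0 at h0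
    rw [hy] at h0
    have hne : u ≠ v.1 := G.ne_of_adj v.2
    have hik := i.2
    rcases y with _ | ⟨v', j⟩
    · exfalso
      simp only [f, phi, branchVertex, prePhi, preE, preB] at h0
      simp [hne] at h0
    · have hne' : u ≠ v'.1 := G.ne_of_adj v'.2
      have hjk := j.2
      by_cases hv : v' = v
      · subst hv
        simp only [f, phi, mkVert, prePhi, preE, preB] at h0
        simp [hne, hne.symm] at h0
        have : i = j := Fin.ext (by omega)
        rw [this]
      · exfalso
        have hv' : v'.1 ≠ v.1 := fun h => hv (Subtype.ext h)
        simp only [f, phi, mkVert, prePhi, preE, preB] at h0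
        simp [hne, hne'.symm, hv'] at h0
  have hinj : Function.Injective f := by
    intro x y hxy
    rcases x with _ | ⟨v, i⟩
    · rcases y with _ | ⟨v, i⟩
      · rfl
      · exact (hinj1 v i none hxy.symm).symm
    · exact hinj1 v i y hxy
  let F : (⊤ : SimpleGraph T) →g fracPower G (2 * k) n := ⟨f, by
    intro x y hxy
    rw [fracPower, powerGraph, SimpleGraph.fromRel_adj]
    refine ⟨fun h => hxy.ne (hinj h), Or.inl ?_⟩
    obtain ⟨w1, h1⟩ := hw x
    obtain ⟨w2, h2⟩ := hw y
    refine ⟨w1.reverse.append w2, ?_⟩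
    rw [SimpleGraph.Walk.length_append, SimpleGraph.Walk.length_reverse]; omega⟩
  have h1 := SimpleGraph.chromaticNumber_mono_of_hom F
  rw [SimpleGraph.chromaticNumber_top] at h1
  refine le_trans (le_of_eq ?_) h1
  simp only [T, Fintype.card_option, Fintype.card_prod, Fintype.card_fin,
    G.card_neighborSet_eq_degree]
  rw [mul_comm]

/-! ### The colouring -/

theorem words_on_edges {V : Type*} [Fintype V] (G : SimpleGraph V) (k D n : ℕ) (hk : 1 ≤ k)
    (hD : 4 ≤ D) (hn : 2 * k < n) (L : V → V → ℕ) (h1 : ∀ u v, G.Adj u v → L u v < D)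
    (h2 : ∀ u v, G.Adj u v → L u v ≠ L v u) :
    ∃ W : V → V → ℕ → ℕ × ℕ, (∀ u v, G.Adj u v → IsWord k D (L u v) (L v u) n (W u v)) ∧
      ∀ u v i, G.Adj u v → i ≤ n → W v u (n - i) = W u v i := by
  classical
  have hw : ∀ u v, ∃ w, G.Adj u v → IsWord k D (L u v) (L v u) n w := by
    intro u v
    by_cases h : G.Adj u v
    · obtain ⟨w, hw⟩ := word_exists k D (L u v) (L v u) hk hD (h1 _ _ h) (h1 _ _ h.symm)
        (h2 _ _ h) n hn
      exact ⟨w, fun _ => hw⟩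
    · exact ⟨fun _ => 0, fun h' => absurd h' h⟩
  choose w hw using hw
  let e := Fintype.equivFin V
  refine ⟨fun u v => if e u < e v then w u v else fun i => w v u (n - i), ?_, ?_⟩
  · intro u v h
    dsimp only
    split_ifs
    · exact hw u v h
    · exact (hw v u h.symm).rev hn
  · intro u v i h hi
    have hne : e u ≠ e v := fun he => h.ne (e.injective he)
    dsimp only
    rcases lt_or_gt_of_ne hne with hlt | hlt
    · rw [if_pos hlt, if_neg (not_lt.2 hlt.le)]
      rw [Nat.sub_sub_self hi]
    · rw [if_pos hlt, if_neg (not_lt.2 hlt.le)]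

theorem upper_bound {V : Type*} [Fintype V] (G : SimpleGraph V) [DecidableRel G.Adj]
    (hconn : G.Connected) (hΔ : 4 ≤ G.maxDegree) (k n : ℕ) (hk : 1 ≤ k) (hn : 2 * k < n) :
    (fracPower G (2 * k) n).Colorable (k * G.maxDegree + 1) := by
  classical
  obtain ⟨L, l1, l2, l3⟩ := graph_labels G (by omega)
  obtain ⟨W, hW, hWf⟩ := words_on_edges G k G.maxDegree n hk hΔ hn L l1 l2
  set D := G.maxDegree with hDdef
  -- the colour of a point
  let C : SubdivVert G n → ℕ × ℕ := Quot.lift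
    (fun x => if x.1.1 = x.1.2.1 then (0, 0) else W x.1.1 x.1.2.1 x.1.2.2) (by
      intro x y h
      cases h with
      | flip u v i h hi => 
        simp only [if_neg h.ne, if_neg h.ne.symm]
        exact (hWf u v i h hi).symm
      | collapse u v h => 
        simp only [if_neg h.ne, if_true]
        exact (hW u v h).start)
  have hC : ∀ {u v : V} (h : G.Adj u v) (i : ℕ) (hi : i ≤ n), C (mkVert G n h i hi) = W u v i := by
    intro u v h i hi
    simp only [C, mkVert, if_neg h.ne]
  -- every vertex has a neighbour
  have hnb : ∀ u, ∃ v, G.Adj u v := by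
    intro u
    have hnt : Nontrivial V := by
      by_contra hcon
      rw [not_nontrivial_iff_subsingleton] at hcon
      have h0 : G.maxDegree ≤ 0 := by
        apply SimpleGraph.maxDegree_le_of_forall_degree_le
        intro v
        rw [Nat.le_zero, SimpleGraph.degree, Finset.card_eq_zero, Finset.eq_empty_iff_forall_notMem]
        intro x hx
        rw [SimpleGraph.mem_neighborFinset] at hx
        exact hx.ne (Subsingleton.elim _ _)
      omega
    exact hconn.preconnected.exists_adj_of_nontrivial u
  have hrep : ∀ x : SubdivVert G n, ∃ (u v : V) (h : G.Adj u v) (i : ℕ) (hi : i ≤ n),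
      x = mkVert G n h i hi := by
    intro x
    induction x using Quot.ind with
    | mk x =>
      obtain ⟨⟨u, v, i⟩, h | h⟩ := x
      · obtain ⟨h1, h2⟩ := h
        dsimp only at h1 h2
        subst h1 h2
        obtain ⟨v, hv⟩ := hnb u
        exact ⟨u, v, hv, 0, Nat.zero_le _, (mkVert_zero G n hv).symm⟩
      · exact ⟨u, v, h.1, i, h.2, rfl⟩
  -- same edge
  have same : ∀ {u v : V} (h : G.Adj u v) (i j : ℕ), i ≤ n → j ≤ n → i ≠ j → i ≤ j + 2 * k →
      j ≤ i + 2 * k → W u v i ≠ W u v j := by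
    intro u v h i j hi hj hij h1 h2
    rcases lt_or_gt_of_ne hij with hlt | hlt
    · exact (hW u v h).dist i j hlt hj h2
    · exact ((hW u v h).dist j i hlt hi h1).symm
  -- different edges at a common branch vertex
  have diff : ∀ {u v v' : V} (h : G.Adj u v) (h' : G.Adj u v') (i j : ℕ), v ≠ v' → 1 ≤ i → 1 ≤ j →
      i ≤ j → i + j ≤ 2 * k → W u v i ≠ W u v' j := by
    intro u v v' h h' i j hv hi hj hij hs
    rw [(hW u v h).left i hi (by omega)]
    by_cases hjk : j ≤ k
    · rw [(hW u v' h').left j hj hjk]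
      intro he
      exact l3 u v v' h h' hv (congrArg Prod.fst he)
    · intro he
      exact (hW u v' h').mid j i (by omega) hi (by omega) (congrArg Prod.snd he).symm
  have proper : ∀ x y : SubdivVert G n, x ≠ y →
      (∃ w : (subdivision G n).Walk x y, w.length ≤ 2 * k) → C x ≠ C y := by
    rintro x y hxy ⟨w, hw⟩
    obtain ⟨p, q, h, s, hs, rfl⟩ := hrep x
    obtain ⟨u, v, h', i, hi, rfl⟩ := hrep y
    rcases near_of_walk G n k hn h h' s i hs hi w hw with ⟨j, hj, e, h1, h2⟩ |
      ⟨a, b, c, hb, hc, i', s', hi', hs', e1, e2, h1⟩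
    · rw [e] at hxy ⊢
      rw [hC, hC]
      apply same h s j hs hj _ h2 h1
      rintro rfl
      exact hxy rfl
    · rw [e1, e2] at hxy ⊢
      by_cases hbc : b = c
      · subst hbc
        rw [hC, hC]
        apply same hb s' i' hs' hi' _ (by omega) (by omega)
        rintro rfl
        exact hxy rfl
      · by_cases hs0 : s' = 0
        · subst hs0
          have e3 : mkVert G n hb 0 hs' = mkVert G n hc 0 hs' :=
            (mkVert_zero G n hb).trans (mkVert_zero G n hc).symm
          rw [e3] at hxy ⊢
          rw [hC, hC]
          apply same hc 0 i' hs' hi' _ (by omega) (by omega)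
          rintro rfl
          exact hxy rfl
        · by_cases hi0 : i' = 0
          · subst hi0
            have e3 : mkVert G n hc 0 hi' = mkVert G n hb 0 hi' :=
              (mkVert_zero G n hc).trans (mkVert_zero G n hb).symm
            rw [e3] at hxy ⊢
            rw [hC, hC]
            exact same hb s' 0 hs' hi' hs0 (by omega) (by omega)
          · rw [hC, hC]
            rcases le_total s' i' with hle | hle
            · exact diff hb hc s' i' hbc (by omega) (by omega) hle (by omega)
            · exact (diff hc hb i' s' (Ne.symm hbc) (by omega) (by omega) hle (by omega)).symm
  -- encode the colours
  have hval : ∀ x, (C x).1 < D ∧ (C x).2 ≤ k ∧ ((C x).2 = 0 → (C x).1 = 0) := by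
    intro x
    obtain ⟨p, q, h, s, hs, rfl⟩ := hrep x
    rw [hC]
    exact ⟨(hW p q h).lab s hs, (hW p q h).ind s hs, (hW p q h).zero s hs⟩
  let E : SubdivVert G n → Option (Fin k × Fin D) := fun x =>
    if h : (C x).2 = 0 then none else
      some (⟨(C x).2 - 1, by have := (hval x).2.1; omega⟩, ⟨(C x).1, (hval x).1⟩)
  have hE : ∀ x y, E x = E y → C x = C y := by
    intro x y hxy
    have hx := hval x
    have hy := hval y
    simp only [E] at hxy
    split_ifs at hxy with h1 h2 h2
    · exact Prod.ext ((hx.2.2 h1).trans (hy.2.2 h2).symm) (h1.trans h2.symm)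
    · simp only [Option.some.injEq, Prod.mk.injEq, Fin.mk.injEq] at hxy
      exact Prod.ext hxy.2 (by omega)
  let col : (fracPower G (2 * k) n).Coloring (Option (Fin k × Fin D)) :=
    SimpleGraph.Coloring.mk E (by
      intro x y hxy he
      rw [fracPower, powerGraph, SimpleGraph.fromRel_adj] at hxy
      rcases hxy.2 with h | h
      · exact proper x y hxy.1 h (hE x y he)
      · exact proper y x hxy.1.symm h (hE x y he).symm)
  have := col.colorable
  simpa using this

theorem chromatic_of_even_power_maxDegree_ge_four {V : Type*} [Fintype V] (G : SimpleGraph V)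
    [DecidableRel G.Adj] (hconn : G.Connected) (hΔ : 4 ≤ G.maxDegree)
    (m n : ℕ) (hm : Even m) (hm2 : 2 ≤ m) (hmn : m < n) :
    (fracPower G m n).chromaticNumber = ((m / 2 * G.maxDegree + 1 : ℕ) : ℕ∞) := by
  obtain ⟨k, hk⟩ := hm
  have hmk : m = 2 * k := by omega
  subst hmk
  have e : 2 * k / 2 = k := by omega
  rw [e]
  apply le_antisymm
  · exact (upper_bound G hconn hΔ k n (by omega) hmn).chromaticNumber_le
  · have : Nonempty V := hconn.nonempty
    obtain ⟨u, hu⟩ := G.exists_maximal_degree_vertex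
    rw [hu]
    exact lower_bound G k n hmn u
end
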